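/- arXiv:0804.1388 — 5 statements merged into one kernel-verified Lean document; each statement's English description precedes it below -/
import Mathlib

section
/- Let A be a completely finite unital complex Banach algebra, let 1 ≤ k ≤ n, and let R ∈ M_{k×n}(A) be a k×n matrix admitting a right inverse B ∈ M_{n×k}(A), i.e. R B = I_k. Then there is an invertible matrix W ∈ M_n(A) whose first k rows form the matrix R and such that the first k columns of W^{-1} form the matrix B. -/
open Matrix

/-- A unital Banach algebra (here: any ring) is *completely finite* if every
right-invertible row `(a_1, …, a_n)` (i.e. one admitting `c_1, …, c_n` with
`∑ a_i c_i = 1`) is the first row of an invertible `n × n` matrix. -/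
def CompletelyFinite (A : Type*) [Ring A] : Prop :=
  ∀ (n : ℕ) (hn : 1 ≤ n) (a : Fin n → A),
    (∃ c : Fin n → A, ∑ i, a i * c i = 1) →
    ∃ W W' : Matrix (Fin n) (Fin n) A, W * W' = 1 ∧ W' * W = 1 ∧
      ∀ j, W ⟨0, Nat.lt_of_lt_of_le Nat.zero_lt_one hn⟩ j = a j

/-- Over a completely finite ring, a row `r` with right inverse `b` has complementary
rectangles `S` and `Y`. -/
theorem CompletelyFinite.exists_complement_row {A : Type*} [Ring A] (hA : CompletelyFinite A)
    {m : ℕ} (r : Matrix Unit (Fin (m + 1)) A) (b : Matrix (Fin (m + 1)) Unit A)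
    (hrb : r * b = 1) :
    ∃ (S : Matrix (Fin m) (Fin (m + 1)) A) (Y : Matrix (Fin (m + 1)) (Fin m) A),
      r * Y = 0 ∧ S * b = 0 ∧ S * Y = 1 ∧ b * r + Y * S = 1 := by
  obtain ⟨W, W', h₁, h₂, hW⟩ := hA (m + 1) (Nat.le_add_left 1 m) (r ())
    ⟨fun i => b i (), by simpa [Matrix.mul_apply] using congr_fun₂ hrb () ()⟩
  let S : Matrix (Fin m) (Fin (m + 1)) A := W.submatrix Fin.succ id
  let X : Matrix (Fin (m + 1)) Unit A := W'.submatrix id fun _ => 0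
  let Y : Matrix (Fin (m + 1)) (Fin m) A := W'.submatrix id Fin.succ
  have hrY : r * Y = 0 := by
    ext i j
    have h := congr_fun₂ h₁ 0 j.succ
    simp only [Matrix.mul_apply] at h
    simp only [Matrix.mul_apply, Y, Matrix.submatrix_apply, id]
    rw [Matrix.one_apply_ne (Fin.succ_ne_zero j).symm] at h
    rw [Matrix.zero_apply, ← h]
    exact Finset.sum_congr rfl fun l _ => by rw [← hW l]; rfl
  have hSY : S * Y = 1 := by
    ext i j
    have h := congr_fun₂ h₁ i.succ j.succ
    simpa [Matrix.mul_apply, Matrix.one_apply, S, Y] using h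
  have hYS : Y * S = 1 - X * r := by
    rw [eq_sub_iff_add_eq', ← h₂]
    ext i j
    simp only [Matrix.add_apply, Matrix.mul_apply, Fin.sum_univ_succ (n := m)]
    simp only [Finset.univ_unique, Finset.sum_singleton]
    rw [← hW j]
    rfl
  refine ⟨S - S * b * r, Y, hrY, ?_, ?_, ?_⟩
  · rw [Matrix.sub_mul, Matrix.mul_assoc _ r, hrb, Matrix.mul_one, sub_self]
  · rw [Matrix.sub_mul, Matrix.mul_assoc _ r, hrY, Matrix.mul_zero, sub_zero, hSY]
  · rw [Matrix.mul_sub, ← Matrix.mul_assoc, ← Matrix.mul_assoc, hYS, Matrix.sub_mul 1,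
      Matrix.mul_assoc X, hrb, Matrix.sub_mul, Matrix.one_mul, Matrix.mul_one]
    abel

/-- Over a completely finite ring, a rectangle `R` with right inverse `B` has complementary
rectangles `S` and `Y`. -/
theorem CompletelyFinite.exists_complement {A : Type*} [Ring A] (hA : CompletelyFinite A)
    {m k : ℕ} (R : Matrix (Fin k) (Fin (m + k)) A) (B : Matrix (Fin (m + k)) (Fin k) A)
    (hRB : R * B = 1) :
    ∃ (S : Matrix (Fin m) (Fin (m + k)) A) (Y : Matrix (Fin (m + k)) (Fin m) A),
      R * Y = 0 ∧ S * B = 0 ∧ S * Y = 1 ∧ B * R + Y * S = 1 := by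
  induction k with
  | zero => exact ⟨1, 1, Subsingleton.elim _ _, Subsingleton.elim _ _, by simp, by
      ext; simp⟩
  | succ k ih =>
    let r : Matrix Unit (Fin (m + k + 1)) A := R.submatrix (fun _ => 0) id
    let b : Matrix (Fin (m + k + 1)) Unit A := B.submatrix id fun _ => 0
    let R' : Matrix (Fin k) (Fin (m + k + 1)) A := R.submatrix Fin.succ id
    let B' : Matrix (Fin (m + k + 1)) (Fin k) A := B.submatrix id Fin.succ
    have hsum (i j : Fin (k + 1)) :
        ∑ l : Fin (m + k + 1), R i l * B l j = (1 : Matrix _ _ A) i j := congr_fun₂ hRB i j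
    have hrb : r * b = 1 := by
      ext i j
      simpa [Matrix.mul_apply, r, b] using hsum 0 0
    have hrB : r * B' = 0 := by
      ext i j
      simpa [Matrix.mul_apply, r, B', Matrix.one_apply, (Fin.succ_ne_zero j).symm]
        using hsum 0 j.succ
    have hRb : R' * b = 0 := by
      ext i j
      simpa [Matrix.mul_apply, R', b, Matrix.one_apply] using hsum i.succ 0
    have hRB' : R' * B' = 1 := by
      ext i j
      simpa [Matrix.mul_apply, R', B', Matrix.one_apply] using hsum i.succ j.succ
    have hBR : B * R = b * r + B' * R' := by
      ext i j
      simp [Matrix.mul_apply, Fin.sum_univ_succ (n := k), b, r, B', R']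
    obtain ⟨S₁, Y₁, hrY, hSb, hSY, hadd⟩ := hA.exists_complement_row r b hrb
    have hYS : Y₁ * S₁ = 1 - b * r := eq_sub_of_add_eq' hadd
    have hYSB : Y₁ * (S₁ * B') = B' := by
      rw [← Matrix.mul_assoc, hYS, Matrix.sub_mul, Matrix.mul_assoc, hrB, Matrix.mul_zero,
        Matrix.one_mul, sub_zero]
    have hRYS : R' * Y₁ * S₁ = R' := by
      rw [Matrix.mul_assoc, hYS, Matrix.mul_sub, ← Matrix.mul_assoc, hRb, Matrix.zero_mul,
        Matrix.mul_one, sub_zero]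
    obtain ⟨S₂, Y₂, hRY₂, hSB₂, hSY₂, hadd₂⟩ := ih (R' * Y₁) (S₁ * B') (by
      rw [Matrix.mul_assoc, hYSB, hRB'])
    refine ⟨S₂ * S₁, Y₁ * Y₂, ?_, ?_, ?_, ?_⟩
    · have h₀ : r * (Y₁ * Y₂) = 0 := by rw [← Matrix.mul_assoc, hrY, Matrix.zero_mul]
      rw [Matrix.mul_assoc] at hRY₂
      ext i j
      cases i using Fin.cases with
      | zero => exact congr_fun₂ h₀ () j
      | succ i => exact congr_fun₂ hRY₂ i j
    · have h₀ : S₂ * S₁ * b = 0 := by rw [Matrix.mul_assoc, hSb, Matrix.mul_zero]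
      rw [← Matrix.mul_assoc] at hSB₂
      ext i j
      cases j using Fin.cases with
      | zero => exact congr_fun₂ h₀ i ()
      | succ j => exact congr_fun₂ hSB₂ i j
    · rw [Matrix.mul_assoc, ← Matrix.mul_assoc S₁, hSY, Matrix.one_mul, hSY₂]
    · have hYS₂ : Y₁ * Y₂ * (S₂ * S₁) = Y₁ * S₁ - B' * R' := by
        rw [Matrix.mul_assoc, ← Matrix.mul_assoc Y₂, eq_sub_of_add_eq' hadd₂, Matrix.sub_mul,
          Matrix.one_mul, Matrix.mul_sub, Matrix.mul_assoc (S₁ * B'), hRYS,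
          ← Matrix.mul_assoc Y₁ (S₁ * B'), hYSB]
      calc B * R + Y₁ * Y₂ * (S₂ * S₁) = b * r + B' * R' + (1 - b * r - B' * R') := by
            rw [hBR, hYS₂, hYS]
        _ = 1 := by abel

/-- **Theorem.** If `A` is a completely finite unital complex Banach algebra,
`1 ≤ k ≤ n`, and the `k × n` matrix `R` has right inverse `B` (`R * B = I_k`),
then there is an invertible `W ∈ M_n(A)` whose first `k` rows form `R` and such
that the first `k` columns of `W⁻¹` form `B`. -/
theorem completelyFinite_complete_rectangles
    {A : Type*} [NormedRing A] [NormedAlgebra ℂ A] [CompleteSpace A]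
    (hA : CompletelyFinite A) (k n : ℕ) (hk : 1 ≤ k) (hkn : k ≤ n)
    (R : Matrix (Fin k) (Fin n) A) (B : Matrix (Fin n) (Fin k) A)
    (hRB : R * B = 1) :
    ∃ W W' : Matrix (Fin n) (Fin n) A, W * W' = 1 ∧ W' * W = 1 ∧
      (∀ (i : Fin k) (j : Fin n), W (Fin.castLE hkn i) j = R i j) ∧
      (∀ (i : Fin n) (j : Fin k), W' i (Fin.castLE hkn j) = B i j) := by
  obtain ⟨m, rfl⟩ := Nat.exists_eq_add_of_le' hkn
  obtain ⟨S, Y, hRY, hSB, hSY, hadd⟩ := hA.exists_complement R B hRB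
  let e : Fin k ⊕ Fin m ≃ Fin (m + k) := finSumFinEquiv.trans (finCongr (Nat.add_comm k m))
  have he (i : Fin k) : e.symm (Fin.castLE hkn i) = Sum.inl i :=
    e.symm_apply_eq.2 (Fin.ext rfl)
  refine ⟨(fromRows R S).submatrix e.symm id, (fromCols B Y).submatrix id e.symm, ?_, ?_, ?_, ?_⟩
  · rw [← Matrix.submatrix_mul _ _ _ _ _ Function.bijective_id, fromRows_mul_fromCols, hRB, hRY,
      hSB, hSY, fromBlocks_one, Matrix.submatrix_one_equiv]
  · rw [← Matrix.submatrix_mul _ _ _ _ _ e.symm.bijective, fromCols_mul_fromRows, hadd,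
      Matrix.submatrix_id_id]
  · intro i j
    simp [he]
  · intro i j
    simp [he]
end

section
/- If a unital complex Banach algebra A is completely finite, then A is stably finite: for every n ≥ 1 and all M, B ∈ M_n(A) with M B = I_n, one also has B M = I_n; that is, every right-invertible element of M_n(A) is invertible. -/
open Matrix

/-- If `M` has a right inverse `B` and its first row is the first basis vector, then `B * M = 1`
as soon as right inverses are two-sided for matrices of the next smaller size. -/
theorem Matrix.mul_eq_one_comm_of_first_row {A : Type*} [Ring A] {n : ℕ}
    (hfin : ∀ N C : Matrix (Fin n) (Fin n) A, N * C = 1 → C * N = 1)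
    {M B : Matrix (Fin (n + 1)) (Fin (n + 1)) A} (hMB : M * B = 1)
    (hM : ∀ j, M 0 j = (1 : Matrix (Fin (n + 1)) (Fin (n + 1)) A) 0 j) : B * M = 1 := by
  have hM0 : M 0 0 = 1 := by simp [hM]
  have hMs : ∀ j : Fin n, M 0 j.succ = 0 := fun j => by
    rw [hM, one_apply_ne (Fin.succ_ne_zero j).symm]
  have entry : ∀ i j, M i 0 * B 0 j + ∑ k : Fin n, M i k.succ * B k.succ j =
      (1 : Matrix (Fin (n + 1)) (Fin (n + 1)) A) i j := fun i j => by
    rw [← hMB, mul_apply, Fin.sum_univ_succ]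
  have hB : ∀ j, B 0 j = (1 : Matrix (Fin (n + 1)) (Fin (n + 1)) A) 0 j := fun j => by
    simpa [hM0, hMs] using entry 0 j
  have hB0 : B 0 0 = 1 := by simp [hB]
  have hBs : ∀ j : Fin n, B 0 j.succ = 0 := fun j => by
    rw [hB, one_apply_ne (Fin.succ_ne_zero j).symm]
  let N : Matrix (Fin n) (Fin n) A := M.submatrix Fin.succ Fin.succ
  let C : Matrix (Fin n) (Fin n) A := B.submatrix Fin.succ Fin.succ
  let x : Fin n → A := fun i => M i.succ 0
  let y : Fin n → A := fun i => B i.succ 0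
  have hNC : N * C = 1 := by
    ext i j
    simpa [hBs, mul_apply, N, C, one_apply] using entry i.succ j.succ
  have hCN : C * N = 1 := hfin N C hNC
  have hxy : x + N *ᵥ y = 0 := by
    ext i
    simpa [hB0, mulVec, dotProduct, N, x, y] using entry i.succ 0
  have hyx : y + C *ᵥ x = 0 := by
    have h := congrArg (C *ᵥ ·) hxy
    simpa [mulVec_add, hCN, add_comm] using h
  ext i j
  rw [mul_apply, Fin.sum_univ_succ]
  refine Fin.cases ?_ (fun i => ?_) i
  · simp [hB0, hBs, hM]
  · refine Fin.cases ?_ (fun j => ?_) j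
    · simpa [hM0, mulVec, dotProduct, C, x, y] using congrFun hyx i
    · simpa [hMs, mul_apply, N, C, one_apply] using congrFun (congrFun hCN i) j

/-- Over a completely finite ring, right inverses of square matrices are two-sided. -/
theorem CompletelyFinite.mul_eq_one_comm {A : Type*} [Ring A] (hA : CompletelyFinite A) (n : ℕ) :
    ∀ M B : Matrix (Fin n) (Fin n) A, M * B = 1 → B * M = 1 := by
  induction n with
  | zero => exact fun _ _ _ => Subsingleton.elim _ _
  | succ n ih =>
    intro M B hMB
    obtain ⟨W, W', hWW', hW'W, hrow⟩ := hA (n + 1) (Nat.le_add_left 1 n) (M 0)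
      ⟨fun i => B i 0, by rw [← mul_apply, hMB, one_apply_eq]⟩
    have hMB' : (M * W') * (W * B) = 1 := by
      rw [Matrix.mul_assoc, ← Matrix.mul_assoc W', hW'W, Matrix.one_mul, hMB]
    have h : (W * B) * (M * W') = 1 := by
      refine Matrix.mul_eq_one_comm_of_first_row ih hMB' fun j => ?_
      rw [← hWW', mul_apply, mul_apply]
      exact Finset.sum_congr rfl fun k _ => by rw [← hrow k]; rfl
    calc B * M = W' * W * (B * M) * (W' * W) := by rw [hW'W, Matrix.one_mul, Matrix.mul_one]
      _ = W' * ((W * B) * (M * W')) * W := by simp only [Matrix.mul_assoc]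
      _ = 1 := by rw [h, Matrix.mul_one, hW'W]

/-- **Corollary.** A completely finite unital complex Banach algebra is stably
finite: every right-invertible element of `M_n(A)` is invertible. -/
theorem completelyFinite_stablyFinite
    {A : Type*} [NormedRing A] [NormedAlgebra ℂ A] [CompleteSpace A]
    (hA : CompletelyFinite A) :
    ∀ (n : ℕ), 1 ≤ n → ∀ (M B : Matrix (Fin n) (Fin n) A), M * B = 1 → B * M = 1 :=
  fun n _ => hA.mul_eq_one_comm n
end

section
/- If a unital complex Banach algebra A is completely finite, then for every k ≥ 1 the matrix algebra M_k(A) is completely finite: for every n ≥ 1, every row (W_1,…,W_n) ∈ M_k(A)^n for which there exist X_1,…,X_n ∈ M_k(A) with ∑_{i=1}^n W_i X_i = I_k occurs as the first row of an invertible matrix in M_n(M_k(A)). -/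
open Matrix

/-- The block lower triangular matrix with diagonal blocks `1`, `Z` and lower left column `b`. -/
def Matrix.borderOne {A : Type*} [Ring A] {m : ℕ} (b : Fin m → A) (Z : Matrix (Fin m) (Fin m) A) :
    Matrix (Fin (m + 1)) (Fin (m + 1)) A :=
  Matrix.of (Fin.cons (Fin.cons 1 0) fun i => Fin.cons (b i) (Z i))

theorem Matrix.borderOne_mul {A : Type*} [Ring A] {m : ℕ} (b b' : Fin m → A)
    (Z Z' : Matrix (Fin m) (Fin m) A) :
    borderOne b Z * borderOne b' Z' = borderOne (b + Z *ᵥ b') (Z * Z') := by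
  ext i j
  refine Fin.cases ?_ (fun i => ?_) i <;> refine Fin.cases ?_ (fun j => ?_) j <;>
    simp [borderOne, Matrix.mul_apply, Fin.sum_univ_succ, Matrix.mulVec, dotProduct]

theorem Matrix.borderOne_zero_one {A : Type*} [Ring A] {m : ℕ} :
    borderOne (0 : Fin m → A) 1 = 1 := by
  ext i j
  refine Fin.cases ?_ (fun i => ?_) i <;> refine Fin.cases ?_ (fun j => ?_) j <;>
    simp [borderOne, Matrix.one_apply, Fin.succ_ne_zero, (Fin.succ_ne_zero _).symm]

/-- Over a completely finite ring, every right-invertible wide matrix consists of the first rows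
of an invertible square matrix. -/
theorem CompletelyFinite.exists_completion {A : Type*} [Ring A] (hA : CompletelyFinite A) {k m : ℕ}
    (hkm : k ≤ m) (W : Matrix (Fin k) (Fin m) A) (X : Matrix (Fin m) (Fin k) A) (hWX : W * X = 1) :
    ∃ V V' : Matrix (Fin m) (Fin m) A, V * V' = 1 ∧ V' * V = 1 ∧
      ∀ i j, V (Fin.castLE hkm i) j = W i j := by
  induction k generalizing m with
  | zero => exact ⟨1, 1, mul_one 1, mul_one 1, fun i => i.elim0⟩
  | succ k ih =>
    obtain ⟨m, rfl⟩ : ∃ l, m = l + 1 := ⟨m - 1, by omega⟩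
    obtain ⟨V, V', hVV', hV'V, hV⟩ := hA (m + 1) (by omega) (W 0)
      ⟨fun j => X j 0, by simpa [Matrix.mul_apply] using congrFun (congrFun hWX 0) 0⟩
    replace hV : ∀ j, V 0 j = W 0 j := hV
    set U := W * V' with hU
    set Y := V * X with hY
    have hUY : U * Y = 1 := by
      rw [hU, hY, Matrix.mul_assoc, ← Matrix.mul_assoc V', hV'V, Matrix.one_mul, hWX]
    have hU0 : ∀ j, U 0 j = (1 : Matrix (Fin (m + 1)) (Fin (m + 1)) A) 0 j := fun j => by
      rw [← hVV', hU, Matrix.mul_apply, Matrix.mul_apply]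
      simp only [hV]
    have hY0 : ∀ j : Fin k, Y 0 j.succ = 0 := fun j => by
      have h := congrFun (congrFun hUY 0) j.succ
      simpa [Matrix.mul_apply, hU0, Matrix.one_apply, (Fin.succ_ne_zero _).symm] using h
    obtain ⟨Z, Z', hZZ', hZ'Z, hZ⟩ := ih (Nat.le_of_succ_le_succ hkm)
      (U.submatrix Fin.succ Fin.succ) (Y.submatrix Fin.succ Fin.succ) (by
        ext i j
        have h := congrFun (congrFun hUY i.succ) j.succ
        simpa [Matrix.mul_apply, Fin.sum_univ_succ, hY0, Matrix.one_apply] using h)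
    let b : Fin m → A := fun i => if h : (i : ℕ) < k then U (Fin.succ ⟨i, h⟩) 0 else 0
    have hT : borderOne b Z * borderOne (-(Z' *ᵥ b)) Z' = 1 := by
      rw [borderOne_mul, Matrix.mulVec_neg, Matrix.mulVec_mulVec, hZZ', Matrix.one_mulVec,
        add_neg_cancel, borderOne_zero_one]
    have hT' : borderOne (-(Z' *ᵥ b)) Z' * borderOne b Z = 1 := by
      rw [borderOne_mul, hZ'Z, neg_add_cancel, borderOne_zero_one]
    have hTU : ∀ i j, borderOne b Z (Fin.castLE hkm i) j = U i j := fun i j => by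
      refine Fin.cases ?_ (fun i => ?_) i
      · rw [hU0]
        refine Fin.cases ?_ (fun j => ?_) j <;>
          simp [borderOne, (Fin.succ_ne_zero _).symm]
      · have hi : Fin.castLE hkm i.succ = (Fin.castLE (Nat.le_of_succ_le_succ hkm) i).succ := rfl
        rw [hi]
        refine Fin.cases ?_ (fun j => ?_) j
        · exact dif_pos i.isLt
        · simpa [borderOne] using hZ i j
    refine ⟨borderOne b Z * V, V' * borderOne (-(Z' *ᵥ b)) Z', ?_, ?_, fun i j => ?_⟩
    · rw [Matrix.mul_assoc, ← Matrix.mul_assoc V, hVV', Matrix.one_mul, hT]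
    · rw [Matrix.mul_assoc, ← Matrix.mul_assoc _ _ V, hT', Matrix.one_mul, hV'V]
    · have hUV : U * V = W := by rw [hU, Matrix.mul_assoc, hV'V, Matrix.mul_one]
      rw [← hUV, Matrix.mul_apply, Matrix.mul_apply]
      simp only [hTU]

/-- Matrix rings over completely finite rings are completely finite. -/
theorem CompletelyFinite.matrix {A : Type*} [Ring A] (hA : CompletelyFinite A) (k : ℕ) :
    CompletelyFinite (Matrix (Fin k) (Fin k) A) := by
  rintro n hn W ⟨X, hWX⟩
  let e : Fin n × Fin k ≃ Fin (n * k) := finProdFinEquiv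
  have hkm : k ≤ n * k := Nat.le_mul_of_pos_left k hn
  obtain ⟨V, V', hVV', hV'V, hV⟩ := hA.exists_completion hkm
    (Matrix.of fun p q => W (e.symm q).1 p (e.symm q).2)
    (Matrix.of fun q p => X (e.symm q).1 (e.symm q).2 p) (by
      ext p q
      rw [← hWX, Matrix.mul_apply, ← e.sum_comp, Fintype.sum_prod_type, Matrix.sum_apply]
      simp [Matrix.mul_apply])
  let φ := compRingEquiv (Fin n) (Fin k) A
  have hmul : ∀ S T : Matrix (Fin (n * k)) (Fin (n * k)) A, S * T = 1 →
      φ.symm (S.submatrix e e) * φ.symm (T.submatrix e e) = 1 := fun S T hST => by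
    rw [← map_mul, Matrix.submatrix_mul_equiv, hST, Matrix.submatrix_one_equiv, map_one]
  refine ⟨φ.symm (V.submatrix e e), φ.symm (V'.submatrix e e), hmul _ _ hVV', hmul _ _ hV'V,
    fun j => ?_⟩
  ext p q
  have he : e (⟨0, hn⟩, p) = Fin.castLE hkm p := Fin.ext (by simp [e])
  change V (e (⟨0, hn⟩, p)) (e (j, q)) = W j p q
  rw [he, hV]
  simp

/-- **Corollary.** If a unital complex Banach algebra `A` is completely finite,
then so is the matrix algebra `M_k(A)` for every `k ≥ 1`. -/
theorem completelyFinite_matrix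
    {A : Type*} [NormedRing A] [NormedAlgebra ℂ A] [CompleteSpace A]
    (hA : CompletelyFinite A) (k : ℕ) (hk : 1 ≤ k) :
    CompletelyFinite (Matrix (Fin k) (Fin k) A) := by
  exact hA.matrix k
end

section
/- Let A be a unital complex Banach algebra and β : A → A a continuous unital algebra homomorphism with β ∘ β = β. Set J = ker β, a closed two-sided ideal of A, and let J̃ = ℂ·1 + J, the unitization of J, which is a closed unital subalgebra of A. Then rtsr(J̃) ≤ rtsr(A): for every n ≥ 1, if Rg_n(A) is dense in A^n, then Rg_n(J̃) is dense in J̃^n. -/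
/-- `RgDenseIn S n` says that the set `Rg_n(S)` of right-invertible `n`-tuples
with entries in the (unital, closed) subalgebra `S ⊆ A` is dense in `S^n`:
every `n`-tuple from `S` can be approximated arbitrarily well by a tuple
`(b_1, …, b_n)` from `S` admitting `(c_1, …, c_n)` in `S` with `∑ b_i c_i = 1`. -/
def RgDenseIn {A : Type*} [NormedRing A] (S : Set A) (n : ℕ) : Prop :=
  ∀ a : Fin n → A, (∀ i, a i ∈ S) → ∀ ε : ℝ, 0 < ε →
    ∃ b c : Fin n → A, (∀ i, b i ∈ S) ∧ (∀ i, c i ∈ S) ∧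
      (∀ i, ‖a i - b i‖ < ε) ∧ ∑ i, b i * c i = 1

section

open Topology Filter

variable {A : Type*} [NormedRing A] [NormedAlgebra ℂ A]

/-- The unitization of `ker β` consists of the elements which `β` sends to scalars. -/
theorem mem_unitization_ker_iff (β : A →ₐ[ℂ] A) (a : A) :
    (∃ (z : ℂ) (j : A), β j = 0 ∧ a = algebraMap ℂ A z + j) ↔
      ∃ z : ℂ, β a = algebraMap ℂ A z := by
  constructor
  · rintro ⟨z, j, hj, rfl⟩
    exact ⟨z, by simp [hj]⟩
  · rintro ⟨z, hz⟩
    exact ⟨z, a - algebraMap ℂ A z, by simp [hz], by simp⟩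

/-- A right inverse of a tuple with scalar images, not all zero, can be replaced by one
with scalar images. -/
theorem exists_rightInverse_scalar_image {n : ℕ} (β : A →ₐ[ℂ] A) {b c : Fin n → A}
    {l : Fin n → ℂ} {k : Fin n} (hk : l k ≠ 0) (hb : ∀ i, β (b i) = algebraMap ℂ A (l i))
    (h : ∑ i, b i * c i = 1) :
    ∃ d : Fin n → A, (∀ i, ∃ z : ℂ, β (d i) = algebraMap ℂ A z) ∧ ∑ i, b i * d i = 1 := by
  set m : Fin n → A := Pi.single k (algebraMap ℂ A (l k)⁻¹) with hm
  have hsum : ∑ i, b i * m i = b k * algebraMap ℂ A (l k)⁻¹ := by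
    rw [Finset.sum_eq_single k]
    · simp [hm]
    · intro i _ hi
      simp [hm, hi]
    · simp
  have hone : β (b k * algebraMap ℂ A (l k)⁻¹) = 1 := by
    rw [map_mul, hb, AlgHom.commutes, ← map_mul, mul_inv_cancel₀ hk, map_one]
  refine ⟨fun i => c i + m i - c i * (b k * algebraMap ℂ A (l k)⁻¹), fun i => ?_, ?_⟩
  · rw [map_sub, map_mul, hone, mul_one, map_add, add_sub_cancel_left]
    by_cases hi : i = k
    · subst hi
      exact ⟨(l i)⁻¹, by simp only [hm, Pi.single_eq_same, AlgHom.commutes]⟩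
    · exact ⟨0, by simp [hm, hi]⟩
  · simp only [mul_sub, mul_add, Finset.sum_sub_distrib, Finset.sum_add_distrib,
      ← mul_assoc (b _) (c _), ← Finset.sum_mul, h, hsum, one_mul, add_sub_cancel_right]

/-- A right invertible tuple stays right invertible after adding right multiples of one
entry to all entries, provided that this entry itself gets multiplied by a unit. -/
theorem exists_rightInverse_add_mul {R : Type*} [Ring R] {n : ℕ} {b c x : Fin n → R}
    {k : Fin n} {v : R} (hv : (1 + x k) * v = 1) (h : ∑ i, b i * c i = 1) :
    ∃ d : Fin n → R, ∑ i, (b i + b k * x i) * d i = 1 := by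
  refine ⟨fun i => c i - Pi.single (M := fun _ => R) k (v * ∑ j, x j * c j) i, ?_⟩
  have hsum : ∑ i, (b i + b k * x i) *
      Pi.single (M := fun _ => R) k (v * ∑ j, x j * c j) i = b k * ∑ j, x j * c j := by
    rw [Finset.sum_eq_single k]
    · rw [Pi.single_eq_same, ← mul_assoc, ← mul_one_add (b k), mul_assoc (b k), hv, mul_one]
    · intro i _ hi
      simp [hi]
    · simp
  simp only [mul_sub, Finset.sum_sub_distrib, hsum]
  simp only [add_mul, Finset.sum_add_distrib, h, mul_assoc, ← Finset.mul_sum,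
    add_sub_cancel_right]

/-- Density of right invertible tuples near tuples whose images are scalars, one of which
is nonzero. -/
theorem exists_rightInvertible_near [CompleteSpace A] (β : A →ₐ[ℂ] A) (hβc : Continuous β)
    (hβ2 : ∀ a, β (β a) = β a) {n : ℕ} (hA : RgDenseIn (Set.univ : Set A) n)
    {a : Fin n → A} {l : Fin n → ℂ} {k : Fin n} (hk : l k ≠ 0)
    (ha : ∀ i, β (a i) = algebraMap ℂ A (l i)) {ε : ℝ} (hε : 0 < ε) :
    ∃ b c : Fin n → A, (∀ i, ∃ z : ℂ, β (b i) = algebraMap ℂ A z) ∧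
      (∀ i, ∃ z : ℂ, β (c i) = algebraMap ℂ A z) ∧
      (∀ i, ‖a i - b i‖ < ε) ∧ ∑ i, b i * c i = 1 := by
  have hunit : IsUnit (β (a k)) := by
    rw [ha]
    exact (IsUnit.mk0 _ hk).map (algebraMap ℂ A)
  set x : (Fin n → A) → Fin n → A :=
    fun b i => Ring.inverse (β (b k)) * (algebraMap ℂ A (l i) - β (b i)) with hx
  have hβk : ContinuousAt (fun b : Fin n → A => β (b k)) a :=
    (hβc.comp (continuous_apply k)).continuousAt
  have hinv : ContinuousAt (fun b : Fin n → A => Ring.inverse (β (b k))) a := by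
    obtain ⟨u, hu⟩ := hunit
    refine ContinuousAt.comp (g := Ring.inverse) ?_ hβk
    rw [← hu]
    exact NormedRing.inverse_continuousAt u
  have hclose : ∀ i, ∀ᶠ b in 𝓝 a, ‖a i - (b i + b k * x b i)‖ < ε := by
    intro i
    have hβi : ContinuousAt (fun b : Fin n → A => β (b i)) a :=
      (hβc.comp (continuous_apply i)).continuousAt
    have hc : ContinuousAt (fun b : Fin n → A => ‖a i - (b i + b k * x b i)‖) a :=
      (continuousAt_const.sub ((continuous_apply i).continuousAt.add
        ((continuous_apply k).continuousAt.mul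
          (hinv.mul (continuousAt_const.sub hβi))))).norm
    refine hc.eventually_lt continuousAt_const ?_
    simpa [hx, ha] using hε
  have hunits : ∀ᶠ b in 𝓝 a, IsUnit (β (b k)) :=
    hβk.eventually (Units.isOpen.mem_nhds hunit)
  obtain ⟨δ, hδ, hball⟩ := Metric.eventually_nhds_iff.1 (hunits.and (eventually_all.2 hclose))
  obtain ⟨b, c, -, -, hab, hbc⟩ := hA a (fun _ => Set.mem_univ _) δ hδ
  obtain ⟨hbk, hnear⟩ := hball (y := b) <| by
    rw [dist_comm, dist_pi_lt_iff hδ]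
    exact fun i => by simpa [dist_eq_norm] using hab i
  have hβinv : β (Ring.inverse (β (b k))) = Ring.inverse (β (b k)) := by
    have h := congrArg β (Ring.inverse_mul_cancel _ hbk)
    rw [map_mul, hβ2, map_one] at h
    exact left_inv_eq_right_inv h (Ring.mul_inverse_cancel _ hbk)
  have himage : ∀ i, β (b i + b k * x b i) = algebraMap ℂ A (l i) := by
    intro i
    simp only [hx, map_add, map_mul, map_sub, hβ2, hβinv, AlgHom.commutes]
    rw [← mul_assoc, Ring.mul_inverse_cancel _ hbk, one_mul, add_sub_cancel]
  have hv : (1 + x b k) * (algebraMap ℂ A (l k)⁻¹ * β (b k)) = 1 := by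
    have hxk : 1 + x b k = Ring.inverse (β (b k)) * algebraMap ℂ A (l k) := by
      simp only [hx, mul_sub, Ring.inverse_mul_cancel _ hbk, add_sub_cancel]
    rw [hxk, mul_assoc, ← mul_assoc (algebraMap ℂ A (l k)), ← map_mul, mul_inv_cancel₀ hk,
      map_one, one_mul, Ring.inverse_mul_cancel _ hbk]
  obtain ⟨d, hd⟩ := exists_rightInverse_add_mul hv hbc
  obtain ⟨e, he, hbe⟩ := exists_rightInverse_scalar_image β hk himage hd
  exact ⟨_, e, fun i => ⟨l i, himage i⟩, he, hnear, hbe⟩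

end

/-- **Theorem (split exact sequences, part (i)).**  Let `β : A → A` be a
continuous idempotent unital algebra endomorphism of a unital complex Banach
algebra `A`, encoding the split exact sequence `0 → J → A → A/J → 0` with
`J = ker β`.  Let `J̃ = ℂ·1 + J` be the unitization of `J`.  Then
`rtsr(J̃) ≤ rtsr(A)`: for every `n ≥ 1`, if `Rg_n(A)` is dense in `A^n`, then
`Rg_n(J̃)` is dense in `J̃^n`. -/
theorem rtsr_unitization_ker_le_of_split
    {A : Type*} [NormedRing A] [NormedAlgebra ℂ A] [CompleteSpace A]
    (β : A →ₐ[ℂ] A) (hβc : Continuous β) (hβ2 : ∀ a, β (β a) = β a)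
    (n : ℕ) (hn : 1 ≤ n)
    (hA : RgDenseIn (Set.univ : Set A) n) :
    RgDenseIn {a : A | ∃ (z : ℂ) (j : A), β j = 0 ∧ a = algebraMap ℂ A z + j} n := by
  intro a ha ε hε
  simp only [Set.mem_ofPred_eq, mem_unitization_ker_iff] at ha ⊢
  choose l hl using ha
  let k : Fin n := ⟨0, hn⟩
  obtain ⟨z, hz0, hz⟩ : ∃ z : ℂ, z ≠ 0 ∧ ‖algebraMap ℂ A (z - l k)‖ < ε / 2 := by
    have hopen : IsOpen {z : ℂ | ‖algebraMap ℂ A (z - l k)‖ < ε / 2} :=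
      isOpen_lt (((algebraMapCLM ℂ A).continuous.comp (continuous_id.sub continuous_const)).norm)
        continuous_const
    have hmem : l k ∈ {z : ℂ | ‖algebraMap ℂ A (z - l k)‖ < ε / 2} := by
      simpa using hε
    obtain ⟨z, hz0, hz⟩ := (dense_compl_singleton (0 : ℂ)).exists_mem_open hopen ⟨l k, hmem⟩
    exact ⟨z, hz0, hz⟩
  let t : Fin n → ℂ := Pi.single k (z - l k)
  obtain ⟨b, c, hb, hc, hab, hbc⟩ := exists_rightInvertible_near β hβc hβ2 hA
    (a := fun i => a i + algebraMap ℂ A (t i)) (l := fun i => l i + t i) (k := k)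
    (by simpa [t] using hz0) (fun i => by simp [hl]) (half_pos hε)
  refine ⟨b, c, hb, hc, fun i => ?_, hbc⟩
  have ht : ‖algebraMap ℂ A (t i)‖ < ε / 2 := by
    by_cases hi : i = k
    · rw [hi]
      simpa only [t, Pi.single_eq_same] using hz
    · simpa [t, hi] using hε
  calc ‖a i - b i‖ = ‖(a i + algebraMap ℂ A (t i) - b i) - algebraMap ℂ A (t i)‖ := by
        congr 1
        abel
    _ ≤ ‖a i + algebraMap ℂ A (t i) - b i‖ + ‖algebraMap ℂ A (t i)‖ := norm_sub_le _ _
    _ < ε := by linarith [hab i]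
end

section
/- Let 𝒩 be a nest on a separable complex Hilbert space H. Then the nest algebra T(𝒩) is completely finite — meaning that for every n ≥ 1, every row (A_1,…,A_n) ∈ T(𝒩)^n for which there exist C_1,…,C_n ∈ T(𝒩) with ∑_{i=1}^n A_i C_i = I occurs as the first row of a matrix in M_n(T(𝒩)) that is invertible with inverse in M_n(T(𝒩)) — if and only if 𝒩 is a countable set and every atom of 𝒩 is finite-dimensional. -/
/-- A *nest* on a Hilbert space `H`: a family of closed subspaces, totally
ordered by inclusion, containing `{0}` and `H`, closed under arbitrary
intersections and under closed linear spans of subfamilies. -/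
structure IsNest {H : Type*} [NormedAddCommGroup H] [InnerProductSpace ℂ H]
    (𝒩 : Set (Submodule ℂ H)) : Prop where
  closed : ∀ N ∈ 𝒩, IsClosed (N : Set H)
  chain : IsChain (· ≤ ·) 𝒩
  bot_mem : (⊥ : Submodule ℂ H) ∈ 𝒩
  top_mem : (⊤ : Submodule ℂ H) ∈ 𝒩
  sInf_mem : ∀ S ⊆ 𝒩, S.Nonempty → sInf S ∈ 𝒩
  closure_sSup_mem : ∀ S ⊆ 𝒩, S.Nonempty → (sSup S).topologicalClosure ∈ 𝒩

/-- The nest algebra `T(𝒩)` of all bounded operators leaving each element of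
the nest invariant. -/
def nestAlg {H : Type*} [NormedAddCommGroup H] [InnerProductSpace ℂ H]
    (𝒩 : Set (Submodule ℂ H)) : Set (H →L[ℂ] H) :=
  {T | ∀ N ∈ 𝒩, ∀ x ∈ N, T x ∈ N}

/-- A (unital, closed) subalgebra `S` of `A` is *completely finite* if every row
in `Rg_n(S)` occurs as the first row of a matrix with entries in `S` which is
invertible with inverse having entries in `S`. -/
def CompletelyFiniteIn {A : Type*} [Ring A] (S : Set A) : Prop :=
  ∀ (n : ℕ) (hn : 1 ≤ n) (a c : Fin n → A),
    (∀ i, a i ∈ S) → (∀ i, c i ∈ S) → ∑ i, a i * c i = 1 →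
    ∃ W W' : Matrix (Fin n) (Fin n) A,
      (∀ i j, W i j ∈ S) ∧ (∀ i j, W' i j ∈ S) ∧
      W * W' = 1 ∧ W' * W = 1 ∧
      ∀ j, W ⟨0, Nat.lt_of_lt_of_le Nat.zero_lt_one hn⟩ j = a j

open Submodule ContinuousLinearMap

local notation "⟪" x "," y "⟫" => inner ℂ x y

section Transfer

variable {E F : Type*} [NormedAddCommGroup E] [InnerProductSpace ℂ E] [CompleteSpace E]
  [NormedAddCommGroup F] [InnerProductSpace ℂ F] [CompleteSpace F]
  {ι : Type*} {f : ι → E} {g : ι → F}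

/-- The partial isometry `x ↦ ∑ ⟪f i, x⟫ • g i` carrying the orthonormal family `f` to the
orthonormal family `g` and vanishing on the orthogonal complement of `f`. -/
noncomputable def orthonormalTransfer (hf : Orthonormal ℂ f) (hg : Orthonormal ℂ g) : E →L[ℂ] F :=
  hg.orthogonalFamily.linearIsometry.toContinuousLinearMap ∘L
    (adjoint hf.orthogonalFamily.linearIsometry.toContinuousLinearMap)

variable (hf : Orthonormal ℂ f) (hg : Orthonormal ℂ g)

theorem hasSum_orthonormalTransfer (x : E) :
    HasSum (fun i ↦ ⟪f i, x⟫ • g i) (orthonormalTransfer hf hg x) := by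
  classical
  have h := hg.orthogonalFamily.hasSum_linearIsometry
    ((adjoint hf.orthogonalFamily.linearIsometry.toContinuousLinearMap) x)
  have e : orthonormalTransfer hf hg x = hg.orthogonalFamily.linearIsometry
    ((adjoint hf.orthogonalFamily.linearIsometry.toContinuousLinearMap) x) := rfl
  rw [e]
  convert h using 2 with i
  rw [LinearIsometry.toSpanSingleton_apply]
  congr 1
  have h1 := lp.inner_single_left (𝕜 := ℂ) (G := fun _ : ι ↦ ℂ) i 1
    ((adjoint hf.orthogonalFamily.linearIsometry.toContinuousLinearMap) x)
  rw [adjoint_inner_right] at h1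
  simpa [OrthogonalFamily.linearIsometry_apply_single] using h1

theorem orthonormalTransfer_apply_self (i : ι) : orthonormalTransfer hf hg (f i) = g i := by
  classical
  refine (hasSum_orthonormalTransfer hf hg (f i)).unique ?_
  convert hasSum_ite_eq i (g i) using 2 with j
  rw [orthonormal_iff_ite.1 hf]
  split_ifs with h
  · simp [h]
  · simp

theorem orthonormalTransfer_apply_of_orthogonal {x : E} (hx : ∀ i, ⟪f i, x⟫ = 0) :
    orthonormalTransfer hf hg x = 0 :=
  (hasSum_orthonormalTransfer hf hg x).unique (by simp [hx])

theorem orthonormalTransfer_mem {K : Submodule ℂ F} (hK : IsClosed (K : Set F)) {x : E}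
    (h : ∀ i, ⟪f i, x⟫ = 0 ∨ g i ∈ K) : orthonormalTransfer hf hg x ∈ K := by
  refine hK.mem_of_tendsto (hasSum_orthonormalTransfer hf hg x)
    (Filter.Eventually.of_forall fun s ↦ K.sum_mem fun i _ ↦ ?_)
  rcases h i with h | h
  · simp [h]
  · exact K.smul_mem _ h

theorem norm_orthonormalTransfer_le : ‖orthonormalTransfer hf hg‖ ≤ 1 := by
  refine (opNorm_comp_le _ _).trans (mul_le_one₀ ?_ (norm_nonneg _) ?_)
  · exact LinearIsometry.norm_toContinuousLinearMap_le _
  · rw [LinearIsometryEquiv.norm_map]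
    exact LinearIsometry.norm_toContinuousLinearMap_le _

theorem inner_orthonormalTransfer_self (x : E) (i : ι) :
    ⟪f i, orthonormalTransfer hf hf x⟫ = ⟪f i, x⟫ := by
  classical
  have h := (hasSum_orthonormalTransfer hf hf x).mapL (innerSL ℂ (f i))
  have e : (fun j ↦ innerSL ℂ (f i) (⟪f j, x⟫ • f j)) = fun j ↦ if j = i then ⟪f i, x⟫ else 0 := by
    ext j
    rw [innerSL_apply_apply, inner_smul_right, orthonormal_iff_ite.1 hf]
    by_cases h : j = i
    · simp [h]
    · simp [h, Ne.symm h]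
  rw [e] at h
  exact h.unique (hasSum_ite_eq i _)

theorem orthonormalTransfer_transfer {G : Type*} [NormedAddCommGroup G] [InnerProductSpace ℂ G]
    [CompleteSpace G] {k : ι → G} (hk : Orthonormal ℂ k) (x : E) :
    orthonormalTransfer hg hk (orthonormalTransfer hf hg x) = orthonormalTransfer hf hk x := by
  have h := (hasSum_orthonormalTransfer hf hg x).mapL (orthonormalTransfer hg hk)
  refine h.unique ?_
  simpa [orthonormalTransfer_apply_self] using hasSum_orthonormalTransfer hf hk x

end Transfer

section Orthonormal

variable {E F : Type*} [NormedAddCommGroup E] [InnerProductSpace ℂ E] [CompleteSpace E]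
  [NormedAddCommGroup F] [InnerProductSpace ℂ F] {ι : Type*} {f : ι → E}

theorem ContinuousLinearMap.ext_of_orthonormal (hf : Orthonormal ℂ f) {X Y : E →L[ℂ] F}
    (h1 : ∀ i, X (f i) = Y (f i))
    (h2 : ∀ x, (∀ i, ⟪f i, x⟫ = 0) → X x = Y x) : X = Y := by
  ext x
  have hs := hasSum_orthonormalTransfer hf hf x
  have e1 : X (orthonormalTransfer hf hf x) = Y (orthonormalTransfer hf hf x) := by
    refine (hs.mapL X).unique ?_
    simpa [h1] using hs.mapL Y
  have e2 := h2 (x - orthonormalTransfer hf hf x) fun i ↦ by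
    rw [inner_sub_right, inner_orthonormalTransfer_self, sub_self]
  rw [map_sub, map_sub, e1] at e2
  exact sub_left_injective e2

theorem ContinuousLinearMap.map_mem_of_orthonormal (hf : Orthonormal ℂ f) (X : E →L[ℂ] F)
    {K : Submodule ℂ F}
    (hK : IsClosed (K : Set F)) (h0 : ∀ x, (∀ i, ⟪f i, x⟫ = 0) → X x = 0) {x : E}
    (h : ∀ i, ⟪f i, x⟫ = 0 ∨ X (f i) ∈ K) : X x ∈ K := by
  have hs := (hasSum_orthonormalTransfer hf hf x).mapL X
  have e2 := h0 (x - orthonormalTransfer hf hf x) fun i ↦ by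
    rw [inner_sub_right, inner_orthonormalTransfer_self, sub_self]
  rw [map_sub, sub_eq_zero] at e2
  rw [e2]
  refine hK.mem_of_tendsto hs (Filter.Eventually.of_forall fun s ↦ K.sum_mem fun i _ ↦ ?_)
  rw [map_smul]
  rcases h i with h | h
  · simp [h]
  · exact K.smul_mem _ h


end Orthonormal

section NestAlgebra

variable {H : Type*} [NormedAddCommGroup H] [InnerProductSpace ℂ H] {𝒩 : Set (Submodule ℂ H)}

/-- The nest algebra as a subalgebra of the bounded operators. -/
def nestSubalgebra (𝒩 : Set (Submodule ℂ H)) : Subalgebra ℂ (H →L[ℂ] H) where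
  carrier := nestAlg 𝒩
  mul_mem' ha hb N hN x hx := ha N hN _ (hb N hN x hx)
  add_mem' ha hb N hN x hx := N.add_mem (ha N hN x hx) (hb N hN x hx)
  algebraMap_mem' r N _ x hx := by
    simpa [Algebra.algebraMap_eq_smul_one] using N.smul_mem r hx

theorem CompletelyFiniteIn.mul_eq_one_comm {A : Type*} [Ring A] {S : Set A}
    (h : CompletelyFiniteIn S) {a c : A} (ha : a ∈ S) (hc : c ∈ S) (hac : a * c = 1) :
    c * a = 1 := by
  obtain ⟨W, W', -, -, h1, h2, h3⟩ := h 1 le_rfl (fun _ ↦ a) (fun _ ↦ c) (fun _ ↦ ha) (fun _ ↦ hc)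
    (by simpa using hac)
  have e := congrFun (congrFun h2 0) 0
  have h3' : W 0 0 = a := h3 0
  simp only [Matrix.mul_apply, Finset.univ_unique, Fin.default_eq_zero, Finset.sum_singleton,
    Matrix.one_apply_eq, h3'] at e
  rwa [left_inv_eq_right_inv e hac] at e

variable [CompleteSpace H]

theorem IsNest.mem_nestSubalgebra_of_orthonormal (h𝒩 : IsNest 𝒩) {ι : Type*} {e : ι → H}
    (he : Orthonormal ℂ e) {X : H →L[ℂ] H} (h0 : ∀ x, (∀ i, ⟪e i, x⟫ = 0) → X x = 0)
    (h : ∀ N ∈ 𝒩, ∀ i, e i ∈ Nᗮ ∨ X (e i) ∈ N) : X ∈ nestSubalgebra 𝒩 := by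
  intro N hN x hx
  refine X.map_mem_of_orthonormal he (h𝒩.closed N hN) h0 fun i ↦ ?_
  exact (h N hN i).imp (fun h ↦ inner_left_of_mem_orthogonal hx h) id

theorem IsNest.finiteDimensional_atom (h𝒩 : IsNest 𝒩) (hfin : CompletelyFiniteIn (nestAlg 𝒩))
    {M N : Submodule ℂ H} (hM : M ∈ 𝒩) (hN : N ∈ 𝒩)
    (hatom : ∀ L ∈ 𝒩, ¬(M < L ∧ L < N)) : FiniteDimensional ℂ ↥(N ⊓ Mᗮ) := by
  by_contra hinf
  have hcl : IsClosed ((N ⊓ Mᗮ : Submodule ℂ H) : Set H) :=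
    (h𝒩.closed N hN).inter M.isClosed_orthogonal
  have : CompleteSpace ↥(N ⊓ Mᗮ) := hcl.completeSpace_coe
  obtain ⟨w, b, hb⟩ := exists_hilbertBasis ℂ ↥(N ⊓ Mᗮ)
  have hw : Infinite w := by
    by_contra hw
    rw [not_infinite_iff_finite] at hw
    have : Fintype w := Fintype.ofFinite w
    exact hinf (b.toOrthonormalBasis.toBasis.finiteDimensional_of_finite)
  let φ := Infinite.natEmbedding w
  let e : ℕ → H := fun n ↦ (b (φ n) : H)
  have he : Orthonormal ℂ e :=
    (b.orthonormal.comp φ φ.injective).comp_linearIsometry (N ⊓ Mᗮ).subtypeₗᵢ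
  have hes : Orthonormal ℂ (fun n ↦ e (n + 1)) := he.comp _ (add_left_injective 1)
  have hmem : ∀ n, e n ∈ N ⊓ Mᗮ := fun n ↦ (b (φ n)).2
  have key : ∀ L ∈ 𝒩, ∀ x ∈ N ⊓ Mᗮ, ∀ n, e n ∈ Lᗮ ∨ x ∈ L := by
    intro L hL x hx n
    by_cases hLM : L ≤ M
    · exact Or.inl (orthogonal_le hLM (hmem n).2)
    · right
      have hML : M < L := lt_of_le_not_ge ((h𝒩.chain.total hM hL).resolve_right hLM) hLM
      have hNL : N ≤ L := by
        rcases h𝒩.chain.total hN hL with h | h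
        · exact h
        · by_contra h'
          exact hatom L hL ⟨hML, lt_of_le_not_ge h h'⟩
      exact hNL hx.1
  set P := orthonormalTransfer he he
  set V := orthonormalTransfer he hes
  set V' := orthonormalTransfer hes he
  have hP : ∀ n, P (e n) = e n := orthonormalTransfer_apply_self he he
  have hV : ∀ n, V (e n) = e (n + 1) := orthonormalTransfer_apply_self he hes
  have hV' : ∀ n, V' (e (n + 1)) = e n := orthonormalTransfer_apply_self hes he
  have hP0 : ∀ x, (∀ i, ⟪e i, x⟫ = 0) → P x = 0 := fun x hx ↦
    orthonormalTransfer_apply_of_orthogonal he he hx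
  have hV0 : ∀ x, (∀ i, ⟪e i, x⟫ = 0) → V x = 0 := fun x hx ↦
    orthonormalTransfer_apply_of_orthogonal he hes hx
  have hV'0 : ∀ x, (∀ i, ⟪e i, x⟫ = 0) → V' x = 0 := fun x hx ↦
    orthonormalTransfer_apply_of_orthogonal hes he fun i ↦ hx (i + 1)
  have hV'e : V' (e 0) = 0 := orthonormalTransfer_apply_of_orthogonal hes he fun i ↦
    he.inner_eq_zero (by simp)
  have mP : P ∈ nestSubalgebra 𝒩 := h𝒩.mem_nestSubalgebra_of_orthonormal he hP0 fun L hL i ↦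
    key L hL _ (by rw [hP]; exact hmem i) i
  have mV : V ∈ nestSubalgebra 𝒩 := h𝒩.mem_nestSubalgebra_of_orthonormal he hV0 fun L hL i ↦
    key L hL _ (by rw [hV]; exact hmem _) i
  have mV' : V' ∈ nestSubalgebra 𝒩 := h𝒩.mem_nestSubalgebra_of_orthonormal he hV'0 fun L hL i ↦
    key L hL _ (by
      rcases i with - | i
      · rw [hV'e]; exact zero_mem _
      · rw [hV']; exact hmem _) i
  have mA : 1 - P + V' ∈ nestSubalgebra 𝒩 := add_mem (sub_mem (one_mem _) mP) mV'
  have mC : 1 - P + V ∈ nestSubalgebra 𝒩 := add_mem (sub_mem (one_mem _) mP) mV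
  have hAC : (1 - P + V') * (1 - P + V) = 1 := by
    refine ext_of_orthonormal he (fun i ↦ ?_) fun x hx ↦ ?_
    · simp [hP, hV, hV']
    · simp [hP0 x hx, hV0 x hx, hV'0 x hx]
  have hCA := DFunLike.congr_fun (hfin.mul_eq_one_comm mA mC hAC) (e 0)
  simp [hP, hV'e] at hCA
  exact he.ne_zero 0 hCA.symm

end NestAlgebra

section Uncountable

theorem Set.exists_densely_ordered_of_not_countable {s : Set ℝ} (hs : ¬ s.Countable) :
    ∃ t ⊆ s, t.Nontrivial ∧ ∀ x ∈ t, ∀ y ∈ t, x < y → ∃ z ∈ t, x < z ∧ z < y := by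
  let B : ℚ → Set ℝ := fun q ↦ {x ∈ s | x < q ∧ (s ∩ Set.Ioo x q).Countable}
  have hB : ∀ q, (B q).Countable := by
    intro q
    have h1 : (⋃ r ∈ {r : ℚ | (s ∩ Set.Ioo (r : ℝ) q).Countable},
        s ∩ Set.Ioo (r : ℝ) q).Countable :=
      (Set.to_countable _).biUnion fun r hr ↦ hr
    set D := ⋃ r ∈ {r : ℚ | (s ∩ Set.Ioo (r : ℝ) q).Countable}, s ∩ Set.Ioo (r : ℝ) q
    have h2 : (B q \ D).Subsingleton := by
      have key : ∀ x ∈ B q, ∀ y ∈ B q \ D, ¬ x < y := by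
        rintro x ⟨hx, hxq, hxc⟩ y ⟨⟨hy, hyq, hyc⟩, hyD⟩ hxy
        obtain ⟨r, hxr, hry⟩ := exists_rat_btwn hxy
        refine hyD (Set.mem_biUnion (x := r) ?_ ⟨hy, hry, hyq⟩)
        exact hxc.mono (Set.inter_subset_inter_right _ (Set.Ioo_subset_Ioo_left hxr.le))
      intro x hx y hy
      exact le_antisymm (not_lt.1 (key y hy.1 x hx)) (not_lt.1 (key x hx.1 y hy))
    refine (h1.union h2.countable).mono fun x hx ↦ ?_
    by_cases hxD : x ∈ D
    · exact Or.inl hxD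
    · exact Or.inr ⟨hx, hxD⟩
  have hU : (⋃ q, B q).Countable := Set.countable_iUnion hB
  refine ⟨s \ ⋃ q, B q, Set.sdiff_subset, ?_, ?_⟩
  · rw [← Set.not_subsingleton_iff]
    intro h
    exact hs ((h.countable.union hU).mono (by rw [Set.sdiff_union_self]; exact Set.subset_union_left))
  · rintro x ⟨hx, hxU⟩ y - hxy
    obtain ⟨q, hxq, hqy⟩ := exists_rat_btwn hxy
    have h3 : ¬ (s ∩ Set.Ioo x q).Countable := fun h ↦
      hxU (Set.mem_iUnion.2 ⟨q, hx, hxq, h⟩)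
    have h4 : ((s ∩ Set.Ioo x q) \ ⋃ q, B q).Nonempty := by
      rw [Set.nonempty_iff_ne_empty]
      intro h
      exact h3 (hU.mono (Set.sdiff_eq_empty.1 h))
    obtain ⟨z, ⟨hz, hxz, hzq⟩, hzU⟩ := h4
    exact ⟨z, ⟨hz, hzU⟩, hxz, hzq.trans hqy⟩

variable {H : Type*} [NormedAddCommGroup H] [InnerProductSpace ℂ H]
  [TopologicalSpace.SeparableSpace H] {𝒩 : Set (Submodule ℂ H)}

theorem exists_strictMonoOn_isClosed :
    ∃ φ : Submodule ℂ H → ℝ, StrictMonoOn φ {N | IsClosed (N : Set H)} := by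
  let x := TopologicalSpace.denseSeq H
  let d : Submodule ℂ H → ℕ → ℝ := fun N k ↦
    (1 / 2 : ℝ) ^ k * (Metric.infDist (x k) (N : Set H) / (1 + ‖x k‖))
  have hd : ∀ N, Summable (d N) := fun N ↦ by
    refine Summable.of_nonneg_of_le (fun k ↦ ?_) (fun k ↦ ?_) summable_geometric_two
    · exact mul_nonneg (by positivity) (div_nonneg Metric.infDist_nonneg (by positivity))
    · refine mul_le_of_le_one_right (by positivity) ((div_le_one (by positivity)).2 ?_)
      have := Metric.infDist_le_dist_of_mem (x := x k) (SetLike.mem_coe.2 N.zero_mem)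
      rw [dist_zero_right] at this
      linarith
  refine ⟨fun N ↦ -∑' k, d N k, fun N hN M hM hNM ↦ neg_lt_neg ?_⟩
  obtain ⟨y, hyM, hyN⟩ := Set.exists_of_ssubset hNM
  have hpos : 0 < Metric.infDist y (N : Set H) :=
    (hN.notMem_iff_infDist_pos ⟨0, N.zero_mem⟩).1 hyN
  obtain ⟨k, hk⟩ := Metric.denseRange_iff.1 (TopologicalSpace.denseRange_denseSeq H) y
    (Metric.infDist y (N : Set H) / 2) (by positivity)
  have h1 : Metric.infDist (x k) (M : Set H) ≤ dist y (x k) := by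
    rw [dist_comm]; exact Metric.infDist_le_dist_of_mem hyM
  have h2 : Metric.infDist y (N : Set H) ≤ Metric.infDist (x k) (N : Set H) + dist y (x k) :=
    Metric.infDist_le_infDist_add_dist
  have h3 : dist y (x k) < Metric.infDist y (N : Set H) / 2 := hk
  refine Summable.tsum_lt_tsum (i := k) (fun j ↦ ?_) ?_ (hd M) (hd N)
  · have := Metric.infDist_le_infDist_of_subset (x := x j) (SetLike.coe_subset_coe.2 hNM.le)
      ⟨0, N.zero_mem⟩
    dsimp only [d]
    gcongr
  · have : Metric.infDist (x k) (M : Set H) < Metric.infDist (x k) (N : Set H) := by linarith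
    dsimp only [d]
    gcongr

theorem IsNest.exists_strictMono (h𝒩 : IsNest 𝒩) (hc : ¬ 𝒩.Countable) (Λ : Type*) [LinearOrder Λ]
    [Countable Λ] : ∃ N : Λ → Submodule ℂ H, StrictMono N ∧ ∀ l, N l ∈ 𝒩 := by
  obtain ⟨φ, hφ⟩ := exists_strictMonoOn_isClosed (H := H)
  replace hφ : StrictMonoOn φ 𝒩 := hφ.mono h𝒩.closed
  have hlt : ∀ M ∈ 𝒩, ∀ N ∈ 𝒩, φ M < φ N → M < N := by
    intro M hM N hN h
    refine lt_of_le_not_ge ((h𝒩.chain.total hM hN).resolve_right fun h' ↦ ?_) fun h' ↦ ?_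
    all_goals exact h.not_ge (hφ.monotoneOn hN hM h')
  have hinj : Set.InjOn φ 𝒩 := by
    intro M hM N hN h
    by_contra hne
    rcases h𝒩.chain.total hM hN with h' | h'
    · exact (hφ hM hN (lt_of_le_of_ne h' hne)).ne h
    · exact (hφ hN hM (lt_of_le_of_ne h' (Ne.symm hne))).ne' h
  obtain ⟨t, hts, ⟨a, ha, b, hb, hab⟩, hdense⟩ := Set.exists_densely_ordered_of_not_countable
    (s := Set.image φ 𝒩) fun h ↦ hc (Set.countable_of_injective_of_countable_image hinj h)
  have : Nontrivial t := ⟨⟨a, ha⟩, ⟨b, hb⟩, by simpa using hab⟩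
  have : DenselyOrdered t := ⟨fun x y hxy ↦ by
    obtain ⟨z, hz, h1, h2⟩ := hdense x x.2 y y.2 hxy
    exact ⟨⟨z, hz⟩, h1, h2⟩⟩
  obtain ⟨ψ⟩ := Order.embedding_from_countable_to_dense Λ t
  choose N hN hNφ using fun l ↦ hts (ψ l).2
  exact ⟨N, fun l m hlm ↦ hlt _ (hN l) _ (hN m) (by rw [hNφ, hNφ]; exact ψ.strictMono hlm), hN⟩

variable [CompleteSpace H]

theorem IsNest.exists_orthonormal (h𝒩 : IsNest 𝒩) (hc : ¬ 𝒩.Countable) (Λ : Type*) [LinearOrder Λ]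
    [Countable Λ] : ∃ e : Λ → H, Orthonormal ℂ e ∧
      ∀ N ∈ 𝒩, ∀ l m, m < l → e l ∈ Nᗮ ∨ e m ∈ N := by
  have : Countable (Λ ×ₗ Bool) := inferInstanceAs (Countable (Λ × Bool))
  obtain ⟨N, hN, hN𝒩⟩ := h𝒩.exists_strictMono hc (Λ ×ₗ Bool)
  have hex : ∀ l : Λ, ∃ x : H, ‖x‖ = 1 ∧ x ∈ N (toLex (l, true)) ∧ x ∈ (N (toLex (l, false)))ᗮ := by
    intro l
    have hlt : N (toLex (l, false)) < N (toLex (l, true)) :=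
      hN (Prod.Lex.right _ (by decide))
    have : CompleteSpace (N (toLex (l, false))) := (h𝒩.closed _ (hN𝒩 _)).completeSpace_coe
    obtain ⟨y, hy1, hy2⟩ := Set.exists_of_ssubset hlt
    set z := y - (N (toLex (l, false))).starProjection y
    have hz : z ∈ (N (toLex (l, false)))ᗮ := sub_starProjection_mem_orthogonal y
    have hz' : z ∈ N (toLex (l, true)) := sub_mem hy1 (hlt.le (starProjection_apply_mem _ y))
    have hz0 : z ≠ 0 := by
      intro h
      rw [sub_eq_zero] at h
      exact hy2 (h ▸ starProjection_apply_mem _ y)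
    refine ⟨((‖z‖⁻¹ : ℝ) : ℂ) • z, ?_, smul_mem _ _ hz', smul_mem _ _ hz⟩
    rw [norm_smul]
    simp [hz0]
  choose e he1 he2 he3 using hex
  have hlt : ∀ l m, m < l → e m ∈ N (toLex (l, false)) := fun l m h ↦
    (hN (Prod.Lex.left _ _ h : (toLex (m, true) : Λ ×ₗ Bool) < toLex (l, false))).le (he2 m)
  refine ⟨e, ⟨he1, ?_⟩, ?_⟩
  · intro l m hlm
    rcases lt_or_gt_of_ne hlm with h | h
    · exact inner_right_of_mem_orthogonal (hlt _ _ h) (he3 m)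
    · exact inner_left_of_mem_orthogonal (hlt _ _ h) (he3 l)
  · intro M hM l m h
    rcases h𝒩.chain.total hM (hN𝒩 (toLex (l, false))) with h' | h'
    · exact Or.inl (orthogonal_le h' (he3 l))
    · exact Or.inr (h' (hlt _ _ h))

end Uncountable

section Tree

theorem Orthonormal.comp_cons {H : Type*} [NormedAddCommGroup H] [InnerProductSpace ℂ H]
    {e : List ℤ → H} (he : Orthonormal ℂ e) (v : ℤ) : Orthonormal ℂ fun u ↦ e (v :: u) :=
  he.comp _ List.cons_injective

theorem Orthonormal.comp_sub_cons {H : Type*} [NormedAddCommGroup H] [InnerProductSpace ℂ H]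
    {e : List ℤ → H} (he : Orthonormal ℂ e) (n : ℤ) :
    Orthonormal ℂ fun p : ℤ × List ℤ ↦ e ((p.1 - n) :: p.2) :=
  he.comp (fun p : ℤ × List ℤ ↦ (p.1 - n) :: p.2) fun p q h ↦ by
    simp only [List.cons.injEq, sub_left_inj] at h
    exact Prod.ext h.1 h.2

variable {H : Type*} [NormedAddCommGroup H] [InnerProductSpace ℂ H] [CompleteSpace H]
  {e : List ℤ → H} (he : Orthonormal ℂ e)

/-- The weight of the child `v` of a node. -/
noncomputable def childWeight (v : ℤ) : ℂ := (1 / 2 : ℂ) ^ v.natAbs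

theorem summable_norm_childWeight : Summable fun v ↦ ‖childWeight v‖ := by
  simp only [childWeight, norm_pow]
  refine Summable.of_nat_of_neg ?_ ?_ <;> simpa using summable_geometric_two

theorem summable_childWeight_sq : Summable fun v : ℤ ↦ (1 / 4 : ℝ) ^ v.natAbs := by
  refine Summable.of_nat_of_neg ?_ ?_ <;>
    simpa using summable_geometric_of_lt_one (r := (1 / 4 : ℝ)) (by norm_num) (by norm_num)

/-- The squared length of the sequence of weights. -/
noncomputable def childWeightSq : ℝ := ∑' v : ℤ, (1 / 4 : ℝ) ^ v.natAbs

theorem childWeightSq_ne_zero : (childWeightSq : ℂ) ≠ 0 := by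
  rw [Complex.ofReal_ne_zero]
  exact (summable_childWeight_sq.tsum_pos (fun _ ↦ by positivity) 0 (by simp)).ne'

theorem hasSum_childWeight_mul_self :
    HasSum (fun v ↦ childWeight v * childWeight v) (childWeightSq : ℂ) := by
  have h : HasSum _ childWeightSq := summable_childWeight_sq.hasSum
  convert Complex.hasSum_ofReal.2 h using 2 with v
  rw [childWeight, ← mul_pow]
  push_cast
  norm_num

theorem childWeight_recurrence (v : ℤ) :
    5 / 2 * childWeight (v + 1) - childWeight (v + 2) - (if v = -1 then 3 / 2 else 0) =
      childWeight v := by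
  simp only [childWeight]
  obtain h | rfl | h : 0 ≤ v ∨ v = -1 ∨ v ≤ -2 := by omega
  · obtain ⟨n, rfl⟩ := Int.eq_ofNat_of_zero_le h
    rw [if_neg (by omega), show (n + 1 : ℤ).natAbs = n + 1 by omega,
      show (n + 2 : ℤ).natAbs = n + 2 by omega, show (n : ℤ).natAbs = n by omega]
    ring
  · norm_num
  · obtain ⟨n, rfl⟩ : ∃ n : ℕ, v = -(n + 2 : ℤ) := ⟨(-v - 2).toNat, by omega⟩
    rw [if_neg (by omega), show (-(n + 2 : ℤ) + 1).natAbs = n + 1 by omega,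
      show (-(n + 2 : ℤ) + 2).natAbs = n by omega, show (-(n + 2 : ℤ)).natAbs = n + 2 by omega]
    ring

theorem childWeight_neg (v : ℤ) : childWeight (-v) = childWeight v := by
  simp [childWeight]

/-- Sends each non-root node to its left neighbour. -/
noncomputable def treeShift : H →L[ℂ] H :=
  orthonormalTransfer (he.comp_sub_cons 0) (he.comp_sub_cons 1)

/-- The operator `5/2 Σ - Σ² - 3 E`, with `Σ` the shift and `E` sending the child `1` of every node
to the child `-1`. -/
noncomputable def treeJ : H →L[ℂ] H :=
  (5 / 2 : ℂ) • treeShift he - treeShift he * treeShift he -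
    (3 : ℂ) • orthonormalTransfer (he.comp_cons 1) (he.comp_cons (-1))

/-- Sends each node to the weighted sum of its children. -/
noncomputable def treeSpread : H →L[ℂ] H :=
  ∑' v, childWeight v • orthonormalTransfer he (he.comp_cons v)

/-- Sends each non-root node to a multiple of its parent. -/
noncomputable def treeGather : H →L[ℂ] H :=
  (childWeightSq : ℂ)⁻¹ • ∑' v, childWeight v • orthonormalTransfer (he.comp_cons v) he

theorem treeShift_cons (w : ℤ) (u : List ℤ) : treeShift he (e (w :: u)) = e ((w - 1) :: u) := by
  have h := orthonormalTransfer_apply_self (he.comp_sub_cons 0) (he.comp_sub_cons 1) (w, u)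
  conv_lhs => rw [← sub_zero w]
  exact h

theorem orthonormalTransfer_cons (w v v' : ℤ) (u : List ℤ) :
    orthonormalTransfer (he.comp_cons v) (he.comp_cons v') (e (w :: u)) =
      if w = v then e (v' :: u) else 0 := by
  split_ifs with h
  · subst h
    exact orthonormalTransfer_apply_self (he.comp_cons w) (he.comp_cons v') u
  · refine orthonormalTransfer_apply_of_orthogonal _ _ fun i ↦ he.inner_eq_zero ?_
    simp [Ne.symm h]

theorem treeJ_cons (w : ℤ) (u : List ℤ) : treeJ he (e (w :: u)) =
    (5 / 2 : ℂ) • e ((w - 1) :: u) - e ((w - 2) :: u) -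
      if w = 1 then (3 : ℂ) • e (-1 :: u) else 0 := by
  change (5 / 2 : ℂ) • treeShift he (e (w :: u)) - treeShift he (treeShift he (e (w :: u))) -
    (3 : ℂ) • orthonormalTransfer (he.comp_cons 1) (he.comp_cons (-1)) (e (w :: u)) = _
  rw [orthonormalTransfer_cons he, treeShift_cons, treeShift_cons, smul_ite, smul_zero, sub_sub w]
  rfl

theorem treeJ_of_forall {x : H} (hx : ∀ w u, ⟪e (w :: u), x⟫ = 0) : treeJ he x = 0 := by
  have h : treeShift he x = 0 := orthonormalTransfer_apply_of_orthogonal _ _ fun i ↦ hx _ _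
  simp [treeJ, h, orthonormalTransfer_apply_of_orthogonal (he.comp_cons 1) (he.comp_cons (-1))
    fun u ↦ hx 1 u]

theorem treeJ_nil : treeJ he (e []) = 0 :=
  treeJ_of_forall he fun _ _ ↦ he.inner_eq_zero (by simp)

theorem hasSum_smul_transfer {f g : ℤ → List ℤ → H} (hf : ∀ v, Orthonormal ℂ (f v))
    (hg : ∀ v, Orthonormal ℂ (g v)) (x : H) :
    HasSum (fun v ↦ childWeight v • orthonormalTransfer (hf v) (hg v) x)
      ((∑' v, childWeight v • orthonormalTransfer (hf v) (hg v)) x) := by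
  have h : Summable fun v ↦ childWeight v • orthonormalTransfer (hf v) (hg v) := by
    refine Summable.of_norm_bounded summable_norm_childWeight fun v ↦ ?_
    rw [norm_smul]
    exact mul_le_of_le_one_right (norm_nonneg _) (norm_orthonormalTransfer_le _ _)
  exact h.hasSum.mapL (ContinuousLinearMap.apply ℂ H x)

theorem hasSum_treeSpread (u : List ℤ) :
    HasSum (fun v ↦ childWeight v • e (v :: u)) (treeSpread he (e u)) := by
  have h := hasSum_smul_transfer (fun _ ↦ he) (fun v ↦ he.comp_cons v) (e u)
  simp only [orthonormalTransfer_apply_self] at h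
  exact h

theorem treeSpread_of_forall {x : H} (hx : ∀ u, ⟪e u, x⟫ = 0) : treeSpread he x = 0 := by
  refine (hasSum_smul_transfer (fun _ ↦ he) (fun v ↦ he.comp_cons v) x).unique ?_
  simp [orthonormalTransfer_apply_of_orthogonal _ _ hx]

theorem treeGather_cons (w : ℤ) (u : List ℤ) :
    treeGather he (e (w :: u)) = ((childWeightSq : ℂ)⁻¹ * childWeight w) • e u := by
  rw [mul_smul, treeGather, smul_apply]
  congr 1
  refine (hasSum_smul_transfer (fun v ↦ he.comp_cons v) (fun _ ↦ he) (e (w :: u))).unique ?_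
  convert hasSum_ite_eq w (childWeight w • e u) using 2 with v
  split_ifs with h
  · subst h
    congr 1
    exact orthonormalTransfer_apply_self (he.comp_cons v) he u
  · rw [orthonormalTransfer_apply_of_orthogonal _ _ fun i ↦ he.inner_eq_zero (by simp [h]),
      smul_zero]

theorem treeGather_of_forall {x : H} (hx : ∀ w u, ⟪e (w :: u), x⟫ = 0) : treeGather he x = 0 := by
  rw [treeGather, smul_apply]
  refine smul_eq_zero_of_right _ ?_
  refine (hasSum_smul_transfer (fun v ↦ he.comp_cons v) (fun _ ↦ he) x).unique ?_
  simp [orthonormalTransfer_apply_of_orthogonal (he.comp_cons _) he (hx _)]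

theorem treeGather_nil : treeGather he (e []) = 0 :=
  treeGather_of_forall he fun _ _ ↦ he.inner_eq_zero (by simp)

theorem treeJ_mul_treeSpread : treeJ he * treeSpread he = treeSpread he := by
  refine ext_of_orthonormal he (fun u ↦ ?_) fun x hx ↦ ?_
  · have h1 := (hasSum_treeSpread he u).mapL (treeJ he)
    refine h1.unique ?_
    have hw (n : ℤ) : ∃ x, HasSum (fun v ↦ childWeight (v + n) • e (v :: u)) x := by
      have h : Summable fun v ↦ ‖childWeight (v + n)‖ :=
        summable_norm_childWeight.comp_injective (add_left_injective n)
      exact (Summable.of_norm_bounded h fun v ↦ by rw [norm_smul, he.1, mul_one] :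
        Summable fun v ↦ childWeight (v + n) • e (v :: u))
    obtain ⟨x₁, h₁⟩ := hw 1
    obtain ⟨x₂, h₂⟩ := hw 2
    have h₃ := hasSum_ite_eq (-1 : ℤ) ((3 / 2 : ℂ) • e (-1 :: u))
    have h₄ := hasSum_ite_eq (1 : ℤ) ((3 / 2 : ℂ) • e (-1 :: u))
    have hx : treeSpread he (e u) = (5 / 2 : ℂ) • x₁ - x₂ - (3 / 2 : ℂ) • e (-1 :: u) := by
      refine (hasSum_treeSpread he u).unique ?_
      convert ((h₁.const_smul (5 / 2 : ℂ)).sub h₂).sub h₃ using 2 with v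
      rw [← childWeight_recurrence v]
      split_ifs with hv
      · subst hv
        module
      · module
    rw [hx]
    rw [← (Equiv.subRight (1 : ℤ)).hasSum_iff] at h₁
    rw [← (Equiv.subRight (2 : ℤ)).hasSum_iff] at h₂
    convert ((h₁.const_smul (5 / 2 : ℂ)).sub h₂).sub h₄ using 2 with v
    rw [map_smul, treeJ_cons]
    simp only [Function.comp_apply, Equiv.subRight_apply, sub_add_cancel]
    split_ifs with hv
    · subst hv
      simp only [childWeight, Int.natAbs_one]
      module
    · module
  · simp [treeSpread_of_forall he hx]

theorem treeGather_mul_treeJ : treeGather he * treeJ he = treeGather he := by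
  refine ext_of_orthonormal he (fun u ↦ ?_) fun x hx ↦ ?_
  · rcases u with - | ⟨w, u⟩
    · simp [treeJ_nil, treeGather_nil]
    · have h := childWeight_recurrence (-w)
      rw [← childWeight_neg (-w), ← childWeight_neg (-w + 1), ← childWeight_neg (-w + 2)] at h
      simp only [neg_add, neg_neg, neg_inj, ← sub_eq_add_neg] at h
      rw [mul_apply_eq_comp, treeJ_cons, treeGather_cons, ← h]
      simp only [map_sub, map_smul, treeGather_cons]
      split_ifs with hw
      · simp only [map_smul, treeGather_cons, childWeight]
        simp
        module
      · simp
        module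
  · simp [treeJ_of_forall he fun w u ↦ hx (w :: u), treeGather_of_forall he fun w u ↦ hx (w :: u)]

theorem treeGather_treeSpread (u : List ℤ) : treeGather he (treeSpread he (e u)) = e u := by
  have h1 := (hasSum_treeSpread he u).mapL (treeGather he)
  refine h1.unique ?_
  have h2 := (hasSum_childWeight_mul_self.mul_left (childWeightSq : ℂ)⁻¹).smul_const (e u)
  rw [inv_mul_cancel₀ childWeightSq_ne_zero, one_smul] at h2
  convert h2 using 2 with v
  rw [map_smul, treeGather_cons, smul_smul]
  ring_nf

theorem treeGather_mul_treeSpread_mul_treeJ :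
    treeGather he * (treeSpread he * treeJ he) = treeJ he := by
  refine ext_of_orthonormal he (fun u ↦ ?_) fun x hx ↦ ?_
  · rcases u with - | ⟨w, u⟩
    · simp [treeJ_nil]
    · simp only [mul_apply_eq_comp, treeJ_cons]
      split_ifs <;> simp [treeGather_treeSpread]
  · simp [treeJ_of_forall he fun w u ↦ hx (w :: u)]

end Tree

section TreeMem

variable {H : Type*} [NormedAddCommGroup H] [InnerProductSpace ℂ H] [CompleteSpace H]
  {𝒩 : Set (Submodule ℂ H)} {e : List ℤ → H}

/-- An orthonormal family indexed by the nodes of a tree is arranged along the nest: everything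
below a left sibling of `w :: u` comes before everything below `w :: u`. -/
def IsArranged (𝒩 : Set (Submodule ℂ H)) (e : List ℤ → H) : Prop :=
  ∀ N ∈ 𝒩, ∀ (u s t : List ℤ) (w w' : ℤ), w' < w → e (t ++ w :: u) ∈ Nᗮ ∨ e (s ++ w' :: u) ∈ N

theorem IsNest.exists_isArranged [TopologicalSpace.SeparableSpace H] (h𝒩 : IsNest 𝒩)
    (hc : ¬ 𝒩.Countable) : ∃ e : List ℤ → H, Orthonormal ℂ e ∧ IsArranged 𝒩 e := by
  obtain ⟨e, he, h⟩ := h𝒩.exists_orthonormal hc (List ℤ)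
  refine ⟨fun l ↦ e l.reverse, he.comp _ List.reverse_injective, fun N hN u s t w w' hw ↦ ?_⟩
  refine h N hN _ _ ?_
  simp only [List.reverse_append, List.reverse_cons, List.append_assoc, List.singleton_append]
  exact List.append_left_lt (List.Lex.rel hw)

variable (he : Orthonormal ℂ e)

theorem treeJ_cons_mem {K : Submodule ℂ H} {w : ℤ} {u : List ℤ}
    (h : ∀ w' < w, e (w' :: u) ∈ K) : treeJ he (e (w :: u)) ∈ K := by
  rw [treeJ_cons]
  refine sub_mem (sub_mem (K.smul_mem _ (h _ (by omega))) (h _ (by omega))) ?_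
  split_ifs with hw
  · exact K.smul_mem _ (h _ (by omega))
  · exact K.zero_mem

theorem treeSpread_mem {K : Submodule ℂ H} (hK : IsClosed (K : Set H)) {u : List ℤ}
    (h : ∀ v, e (v :: u) ∈ K) : treeSpread he (e u) ∈ K :=
  hK.mem_of_tendsto (hasSum_treeSpread he u)
    (Filter.Eventually.of_forall fun _ ↦ K.sum_mem fun v _ ↦ K.smul_mem _ (h v))

theorem IsArranged.treeJ_mem (ha : IsArranged 𝒩 e) (h𝒩 : IsNest 𝒩) :
    treeJ he ∈ nestSubalgebra 𝒩 := by
  refine h𝒩.mem_nestSubalgebra_of_orthonormal he (fun x hx ↦ treeJ_of_forall he fun w u ↦ hx _)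
    fun N hN l ↦ or_iff_not_imp_left.2 fun hl ↦ ?_
  rcases l with - | ⟨w, u⟩
  · rw [treeJ_nil]
    exact N.zero_mem
  · exact treeJ_cons_mem he fun w' hw ↦ (ha N hN u [] [] w w' hw).resolve_left hl

theorem IsArranged.treeSpread_mul_treeJ_mem (ha : IsArranged 𝒩 e) (h𝒩 : IsNest 𝒩) :
    treeSpread he * treeJ he ∈ nestSubalgebra 𝒩 := by
  refine h𝒩.mem_nestSubalgebra_of_orthonormal he
    (fun x hx ↦ by rw [mul_apply_eq_comp, treeJ_of_forall he fun w u ↦ hx _, map_zero])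
    fun N hN l ↦ or_iff_not_imp_left.2 fun hl ↦ ?_
  rw [mul_apply_eq_comp]
  rcases l with - | ⟨w, u⟩
  · rw [treeJ_nil, map_zero]
    exact N.zero_mem
  · exact treeJ_cons_mem (K := N.comap (treeSpread he : H →ₗ[ℂ] H)) he fun w' hw ↦
      treeSpread_mem he (h𝒩.closed N hN) fun v ↦ (ha N hN u [v] [] w w' hw).resolve_left hl

theorem IsArranged.treeJ_mul_treeGather_mem (ha : IsArranged 𝒩 e) (h𝒩 : IsNest 𝒩) :
    treeJ he * treeGather he ∈ nestSubalgebra 𝒩 := by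
  refine h𝒩.mem_nestSubalgebra_of_orthonormal he
    (fun x hx ↦ by rw [mul_apply_eq_comp, treeGather_of_forall he fun w u ↦ hx _, map_zero])
    fun N hN l ↦ or_iff_not_imp_left.2 fun hl ↦ ?_
  rw [mul_apply_eq_comp]
  rcases l with - | ⟨v, - | ⟨w, u⟩⟩
  · rw [treeGather_nil, map_zero]
    exact N.zero_mem
  · rw [treeGather_cons, map_smul, treeJ_nil, smul_zero]
    exact N.zero_mem
  · rw [treeGather_cons, map_smul]
    exact N.smul_mem _ (treeJ_cons_mem he fun w' hw ↦
      (ha N hN u [] [v] w w' hw).resolve_left hl)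

end TreeMem

theorem IsNest.countable_of_completelyFiniteIn {H : Type*} [NormedAddCommGroup H]
    [InnerProductSpace ℂ H] [CompleteSpace H] [TopologicalSpace.SeparableSpace H]
    {𝒩 : Set (Submodule ℂ H)} (h𝒩 : IsNest 𝒩) (hfin : CompletelyFiniteIn (nestAlg 𝒩)) :
    𝒩.Countable := by
  by_contra hc
  obtain ⟨e, he, ha⟩ := h𝒩.exists_isArranged hc
  have mJ := ha.treeJ_mem he h𝒩
  have mSJ := ha.treeSpread_mul_treeJ_mem he h𝒩
  have mJG := ha.treeJ_mul_treeGather_mem he h𝒩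
  have hJS := treeJ_mul_treeSpread he
  have hGJ := treeGather_mul_treeJ he
  have hGSJ := treeGather_mul_treeSpread_mul_treeJ he
  have hJe := treeJ_nil he
  have hGSe := treeGather_treeSpread he []
  have hJSe : treeJ he (treeSpread he (e [])) = treeSpread he (e []) :=
    DFunLike.congr_fun hJS (e [])
  set J := treeJ he
  set S := treeSpread he
  set G := treeGather he
  have h2 : (2 : H →L[ℂ] H) ∈ nestSubalgebra 𝒩 := ofNat_mem _ 2
  have h3 : (3 : H →L[ℂ] H) ∈ nestSubalgebra 𝒩 := ofNat_mem _ 3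
  have mA : 1 + J - 2 * (J * J) + (3 - 2 * J) * (J * G) ∈ nestSubalgebra 𝒩 :=
    add_mem (sub_mem (add_mem (one_mem _) mJ) (mul_mem h2 (mul_mem mJ mJ)))
      (mul_mem (sub_mem h3 (mul_mem h2 mJ)) mJG)
  have mC : 1 - J + S * J ∈ nestSubalgebra 𝒩 := add_mem (sub_mem (one_mem _) mJ) mSJ
  have hAC : (1 + J - 2 * (J * J) + (3 - 2 * J) * (J * G)) * (1 - J + S * J) = 1 := by
    have hJSJ : J * (S * J) = S * J := by rw [← mul_assoc, hJS]
    have hGC : G * (1 - J + S * J) = J := by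
      rw [mul_add, mul_sub, hGJ, hGSJ, mul_one, sub_self, zero_add]
    have hJC : J * (1 - J + S * J) = J - J * J + S * J := by
      rw [mul_add, mul_sub, hJSJ, mul_one]
    have hJJC : J * (J - J * J + S * J) = J * J - J * (J * J) + S * J := by
      rw [mul_add, mul_sub, hJSJ]
    simp only [add_mul, sub_mul, mul_assoc, hGC, hJC, hJJC, one_mul]
    noncomm_ring
  have hCA := DFunLike.congr_fun (hfin.mul_eq_one_comm mA mC hAC) (S (e []))
  have hA : (1 + J - 2 * (J * J) + (3 - 2 * J) * (J * G)) (S (e [])) = 0 := by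
    have e2 : ∀ x, (2 : H →L[ℂ] H) x = x + x := fun x ↦ by rw [← one_add_one_eq_two]; simp
    simp [hJSe, hGSe, hJe, e2]
  rw [mul_apply_eq_comp, hA, map_zero] at hCA
  have hSe : S (e []) = 0 := hCA.symm
  rw [hSe, map_zero] at hGSe
  exact he.ne_zero [] hGSe.symm

section Atomic

/-- `M < N` are consecutive elements of the nest. -/
def IsNestAtom {H : Type*} [NormedAddCommGroup H] [InnerProductSpace ℂ H]
    (𝒩 : Set (Submodule ℂ H)) (M N : Submodule ℂ H) : Prop :=
  M ∈ 𝒩 ∧ N ∈ 𝒩 ∧ M < N ∧ ∀ L ∈ 𝒩, ¬(M < L ∧ L < N)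

/-- A monotone map from a nest to the closed subspaces of another space which fixes zero and
respects the nest operations. -/
structure IsNestMap {H G : Type*} [NormedAddCommGroup H] [InnerProductSpace ℂ H]
    [NormedAddCommGroup G] [InnerProductSpace ℂ G] (𝒩 : Set (Submodule ℂ H))
    (Φ : Submodule ℂ H → Submodule ℂ G) : Prop where
  mono : Monotone Φ
  closed : ∀ N ∈ 𝒩, IsClosed (Φ N : Set G)
  map_bot : Φ ⊥ = ⊥
  map_sSup : ∀ S ⊆ 𝒩, Φ (sSup S).topologicalClosure ≤ (⨆ L : S, Φ L).topologicalClosure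
  map_sInf : ∀ S ⊆ 𝒩, S.Nonempty → ⨅ L : S, Φ L ≤ Φ (sInf S)

variable {H G : Type*} [NormedAddCommGroup H] [InnerProductSpace ℂ H]
    [NormedAddCommGroup G] [InnerProductSpace ℂ G] {𝒩 : Set (Submodule ℂ H)}
    {Φ Ψ : Submodule ℂ H → Submodule ℂ G}

theorem IsNestAtom.le_or_le (h𝒩 : IsNest 𝒩) {M N L : Submodule ℂ H} (h : IsNestAtom 𝒩 M N)
    (hL : L ∈ 𝒩) : L ≤ M ∨ N ≤ L := by
  obtain ⟨hM, hN, hMN, hat⟩ := h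
  by_contra! hc
  exact hat L hL ⟨lt_of_le_not_ge ((h𝒩.chain.total hL hM).resolve_left hc.1) hc.1,
    lt_of_le_not_ge ((h𝒩.chain.total hL hN).resolve_right hc.2) hc.2⟩

theorem norm_inner_le_of_mem_closure_iSup {ι : Type*} [Nonempty ι] {V : ι → Submodule ℂ G}
    (hV : Directed (· ≤ ·) V) {x : G} {r : ℝ} (h : ∀ i, ∀ z ∈ V i, ‖⟪z, x⟫‖ ≤ r * ‖z‖) {z : G}
    (hz : z ∈ (⨆ i, V i).topologicalClosure) : ‖⟪z, x⟫‖ ≤ r * ‖z‖ := by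
  have hcl : IsClosed {z : G | ‖⟪z, x⟫‖ ≤ r * ‖z‖} :=
    isClosed_le (by fun_prop) (by fun_prop)
  refine closure_minimal (fun y hy ↦ ?_) hcl hz
  obtain ⟨i, hi⟩ := (mem_iSup_of_directed V hV).1 hy
  exact h i y hi

variable [CompleteSpace G]

theorem IsNestMap.eq_zero_of_orthogonal_atoms (h𝒩 : IsNest 𝒩) (hc : 𝒩.Countable)
    (hΦ : IsNestMap 𝒩 Φ) {x : G} (hx : x ∈ Φ ⊤)
    (h : ∀ M N, IsNestAtom 𝒩 M N → ∀ y ∈ Φ N ⊓ (Φ M)ᗮ, ⟪y, x⟫ = 0) : x = 0 := by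
  have hp : ∀ L : 𝒩, ∃ y ∈ Φ L, x - y ∈ (Φ L)ᗮ := fun L ↦ by
    have : CompleteSpace (Φ L) := (hΦ.closed L L.2).completeSpace_coe
    exact ⟨(Φ L).starProjection x, starProjection_apply_mem _ x,
      sub_starProjection_mem_orthogonal x⟩
  choose p hp hq using hp
  have hinc : ∀ L L' : 𝒩, L ≤ L' → p L' - p L ∈ (Φ L)ᗮ := fun L L' hL ↦ by
    have := sub_mem (hq L) (orthogonal_le (hΦ.mono hL) (hq L'))
    rwa [sub_sub_sub_cancel_left] at this
  have hpx : ∀ L : 𝒩, ∀ z ∈ Φ L, ⟪z, x⟫ = ⟪z, p L⟫ := fun L z hz ↦ by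
    have := inner_right_of_mem_orthogonal hz (hq L)
    rwa [inner_sub_right, sub_eq_zero] at this
  have hqx : ∀ L : 𝒩, ∀ z ∈ (Φ L)ᗮ, ⟪z, x⟫ = ⟪z, x - p L⟫ := fun L z hz ↦ by
    rw [inner_sub_right, inner_left_of_mem_orthogonal (hp L) hz, sub_zero]
  have hpyth : ∀ L L' : 𝒩, L ≤ L' → ‖p L'‖ ^ 2 = ‖p L‖ ^ 2 + ‖p L' - p L‖ ^ 2 := fun L L' hL ↦ by
    have := norm_add_sq_eq_norm_sq_add_norm_sq_of_inner_eq_zero (𝕜 := ℂ) (p L) (p L' - p L)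
      (inner_right_of_mem_orthogonal (hp L) (hinc L L' hL))
    rw [add_sub_cancel] at this
    simpa only [sq] using this
  have hpythx : ∀ L, ‖x‖ ^ 2 = ‖p L‖ ^ 2 + ‖x - p L‖ ^ 2 := fun L ↦ by
    have := norm_add_sq_eq_norm_sq_add_norm_sq_of_inner_eq_zero (𝕜 := ℂ) (p L) (x - p L)
      (inner_right_of_mem_orthogonal (hp L) (hq L))
    rw [add_sub_cancel] at this
    simpa only [sq] using this
  have hle : ∀ L L' : 𝒩, ‖p L‖ ^ 2 < ‖p L'‖ ^ 2 → L ≤ L' := fun L L' hlt ↦ by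
    refine (h𝒩.chain.total L.2 L'.2).resolve_right fun hL ↦ ?_
    have := hpyth L' L hL
    nlinarith [sq_nonneg ‖p L - p L'‖]
  have hbot : p ⟨⊥, h𝒩.bot_mem⟩ = 0 := by
    have := hp ⟨⊥, h𝒩.bot_mem⟩
    rwa [hΦ.map_bot, mem_bot] at this
  have htop : p ⟨⊤, h𝒩.top_mem⟩ = x := by
    have h1 := inner_right_of_mem_orthogonal (sub_mem hx (hp ⟨⊤, h𝒩.top_mem⟩)) (hq ⟨⊤, h𝒩.top_mem⟩)
    rw [inner_self_eq_zero, sub_eq_zero] at h1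
    exact h1.symm
  by_contra hx0
  have hc' : (Set.range fun L : 𝒩 ↦ ‖p L‖ ^ 2).Countable := by
    have := hc.to_subtype
    exact Set.countable_range _
  obtain ⟨t, ht, ht0, htx⟩ := hc'.dense_compl ℝ |>.exists_between
    (show (0 : ℝ) < ‖x‖ ^ 2 by positivity)
  have hne : ∀ L, ‖p L‖ ^ 2 ≠ t := fun L hL ↦ ht ⟨L, hL⟩
  let S₁ : Set (Submodule ℂ H) := {L | ∃ hL : L ∈ 𝒩, ‖p ⟨L, hL⟩‖ ^ 2 < t}
  let S₂ : Set (Submodule ℂ H) := {L | ∃ hL : L ∈ 𝒩, t < ‖p ⟨L, hL⟩‖ ^ 2}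
  have hS₁ : S₁ ⊆ 𝒩 := fun L hL ↦ hL.1
  have hS₂ : S₂ ⊆ 𝒩 := fun L hL ↦ hL.1
  have hn₁ : S₁.Nonempty := ⟨⊥, h𝒩.bot_mem, by simpa [hbot] using ht0⟩
  have hn₂ : S₂.Nonempty := ⟨⊤, h𝒩.top_mem, by simpa [htop] using htx⟩
  have := hn₁.to_subtype
  have := hn₂.to_subtype
  let M : 𝒩 := ⟨(sSup S₁).topologicalClosure, h𝒩.closure_sSup_mem S₁ hS₁ hn₁⟩
  let N : 𝒩 := ⟨sInf S₂, h𝒩.sInf_mem S₂ hS₂ hn₂⟩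
  have hsq : ∀ {a r : ℝ}, 0 ≤ a → a ^ 2 ≤ √r * a → 0 < r → a ^ 2 ≤ r := fun {a r} ha har hr ↦ by
    have h2 := Real.sqrt_nonneg r
    have h3 := Real.sq_sqrt hr.le
    have : a ≤ √r := by
      by_contra! hlt
      nlinarith
    nlinarith
  have hM : ‖p M‖ ^ 2 < t := by
    refine lt_of_le_of_ne (hsq (norm_nonneg _) ?_ ht0) (hne M)
    have h1 : p M ∈ (⨆ L : S₁, Φ L).topologicalClosure := hΦ.map_sSup S₁ hS₁ (hp M)
    have hdir : Directed (· ≤ ·) fun L : S₁ ↦ Φ L := fun L L' ↦ by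
      rcases h𝒩.chain.total (hS₁ L.2) (hS₁ L'.2) with hl | hl
      · exact ⟨L', hΦ.mono hl, le_rfl⟩
      · exact ⟨L, le_rfl, hΦ.mono hl⟩
    have h2 := norm_inner_le_of_mem_closure_iSup hdir (x := x) (r := √t) (fun L z hz ↦ by
      obtain ⟨L, hL, hlt⟩ := L
      rw [hpx ⟨L, hL⟩ z hz]
      refine (norm_inner_le_norm _ _).trans ?_
      rw [mul_comm]
      exact mul_le_mul_of_nonneg_right (Real.le_sqrt_of_sq_le hlt.le) (norm_nonneg _)) h1
    rw [hpx M _ (hp M), inner_self_eq_norm_sq_to_K] at h2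
    simpa using h2
  have hN : t < ‖p N‖ ^ 2 := by
    refine lt_of_le_of_ne ?_ (hne N).symm
    have hlt : 0 < ‖x‖ ^ 2 - t := by linarith
    suffices hs : ‖x - p N‖ ^ 2 ≤ ‖x‖ ^ 2 - t by linarith [hpythx N]
    refine hsq (norm_nonneg _) ?_ hlt
    have h1 : x - p N ∈ (⨆ L : S₂, (Φ L)ᗮ).topologicalClosure := by
      have h2 := orthogonal_le (hΦ.map_sInf S₂ hS₂ hn₂) (hq N)
      rw [← orthogonal_orthogonal_eq_closure, ← iInf_orthogonal]
      refine orthogonal_le (iInf_mono fun L ↦ ?_) h2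
      rw [orthogonal_orthogonal_eq_closure]
      exact ((hΦ.closed L (hS₂ L.2)).submodule_topologicalClosure_eq).le
    have hdir : Directed (· ≤ ·) fun L : S₂ ↦ (Φ L)ᗮ := fun L L' ↦ by
      rcases h𝒩.chain.total (hS₂ L.2) (hS₂ L'.2) with hl | hl
      · exact ⟨L, le_rfl, orthogonal_le (hΦ.mono hl)⟩
      · exact ⟨L', orthogonal_le (hΦ.mono hl), le_rfl⟩
    have h2 := norm_inner_le_of_mem_closure_iSup hdir (x := x) (r := √(‖x‖ ^ 2 - t))
      (fun L z hz ↦ by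
        obtain ⟨L, hL, hlt⟩ := L
        rw [hqx ⟨L, hL⟩ z hz]
        refine (norm_inner_le_norm _ _).trans ?_
        rw [mul_comm]
        refine mul_le_mul_of_nonneg_right (Real.le_sqrt_of_sq_le ?_) (norm_nonneg _)
        linarith [hpythx ⟨L, hL⟩]) h1
    rw [hqx N _ (hq N), inner_self_eq_norm_sq_to_K] at h2
    simpa using h2
  have hMN : M ≤ N := hle M N (hM.trans hN)
  have hne' : p N - p M ≠ 0 := fun h0 ↦ by
    rw [sub_eq_zero] at h0
    rw [h0] at hN
    exact lt_asymm hM hN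
  have hat : IsNestAtom 𝒩 M N := by
    refine ⟨M.2, N.2, lt_of_le_of_ne hMN fun he ↦ hne' ?_, fun L hL ⟨h1, h2⟩ ↦ ?_⟩
    · rw [Subtype.ext he, sub_self]
    · rcases lt_or_gt_of_ne (hne ⟨L, hL⟩) with hl | hl
      · exact h1.not_ge ((le_sSup (show L ∈ S₁ from ⟨hL, hl⟩)).trans (le_topologicalClosure _))
      · exact h2.not_ge (sInf_le (show L ∈ S₂ from ⟨hL, hl⟩))
  have hmem : p N - p M ∈ Φ N ⊓ (Φ M)ᗮ := ⟨sub_mem (hp N) (hΦ.mono hMN (hp M)), hinc M N hMN⟩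
  have h0 := h M N hat _ hmem
  rw [hpx N _ hmem.1] at h0
  refine hne' (inner_self_eq_zero (𝕜 := ℂ).1 ?_)
  rw [inner_sub_right, h0, inner_left_of_mem_orthogonal (hp M) hmem.2, sub_zero]

theorem IsNestMap.exists_orthonormal (h𝒩 : IsNest 𝒩) (hc : 𝒩.Countable)
    (hΦ : IsNestMap 𝒩 Φ) (d : {p : Submodule ℂ H × Submodule ℂ H // IsNestAtom 𝒩 p.1 p.2} → ℕ)
    (hfd : ∀ a : {p : Submodule ℂ H × Submodule ℂ H // IsNestAtom 𝒩 p.1 p.2},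
      FiniteDimensional ℂ ↥(Φ a.1.2 ⊓ (Φ a.1.1)ᗮ))
    (hd : ∀ a, Module.finrank ℂ ↥(Φ a.1.2 ⊓ (Φ a.1.1)ᗮ) = d a) :
    ∃ f : (Σ a, Fin (d a)) → G, Orthonormal ℂ f ∧
      (∀ i, f i ∈ Φ i.1.1.2 ⊓ (Φ i.1.1.1)ᗮ) ∧
      ∀ x ∈ Φ ⊤, (∀ i, ⟪f i, x⟫ = 0) → x = 0 := by
  let b := fun a ↦ (stdOrthonormalBasis ℂ ↥(Φ a.1.2 ⊓ (Φ a.1.1)ᗮ)).reindex (finCongr (hd a))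
  refine ⟨fun i ↦ b i.1 i.2, ⟨fun i ↦ ?_, ?_⟩, fun i ↦ (b i.1 i.2).2, fun x hx h ↦ ?_⟩
  · exact (b i.1).orthonormal.1 i.2
  · rintro ⟨a, i⟩ ⟨a', j⟩ hij
    by_cases haa : a = a'
    · subst haa
      exact (b a).orthonormal.2 fun h : i = j ↦ hij (by rw [h])
    have hlt : a.1.2 ≤ a'.1.1 ∨ a'.1.2 ≤ a.1.1 := by
      rcases a'.2.le_or_le h𝒩 a.2.2.1 with h1 | h1
      · exact Or.inl h1
      rcases a.2.le_or_le h𝒩 a'.2.2.1 with h2 | h2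
      · exact Or.inr h2
      have e2 := le_antisymm h1 h2
      refine absurd (Subtype.ext (Prod.ext ?_ e2.symm)) haa
      refine le_antisymm ((a'.2.le_or_le h𝒩 a.2.1).resolve_right fun h ↦ ?_)
        ((a.2.le_or_le h𝒩 a'.2.1).resolve_right fun h ↦ ?_)
      · rw [e2] at h; exact a.2.2.2.1.not_ge h
      · rw [← e2] at h; exact a'.2.2.2.1.not_ge h
    rcases hlt with hlt | hlt
    · exact inner_right_of_mem_orthogonal (hΦ.mono hlt (b a i).2.1) (b a' j).2.2
    · exact inner_left_of_mem_orthogonal (hΦ.mono hlt (b a' j).2.1) (b a i).2.2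
  · refine hΦ.eq_zero_of_orthogonal_atoms h𝒩 hc hx fun M N hat y hy ↦ ?_
    let a : {p : Submodule ℂ H × Submodule ℂ H // IsNestAtom 𝒩 p.1 p.2} := ⟨(M, N), hat⟩
    have hs := congrArg Subtype.val ((b a).sum_repr ⟨y, hy⟩)
    rw [Submodule.coe_sum] at hs
    rw [← show _ = y from hs, sum_inner]
    refine Finset.sum_eq_zero fun i _ ↦ ?_
    rw [Submodule.coe_smul, inner_smul_left, h ⟨a, i⟩, mul_zero]

section

variable {ι : Type*} {a : ι → Submodule ℂ H × Submodule ℂ H} {f g : ι → G}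

theorem IsNestMap.orthonormalTransfer_mem (h𝒩 : IsNest 𝒩) (hΦ : IsNestMap 𝒩 Φ)
    (hΨ : IsNestMap 𝒩 Ψ) (ha : ∀ i, IsNestAtom 𝒩 (a i).1 (a i).2) (hf : Orthonormal ℂ f)
    (hg : Orthonormal ℂ g) (hfm : ∀ i, f i ∈ Φ (a i).2 ⊓ (Φ (a i).1)ᗮ)
    (hgm : ∀ i, g i ∈ Ψ (a i).2 ⊓ (Ψ (a i).1)ᗮ) {L : Submodule ℂ H} (hL : L ∈ 𝒩) {x : G}
    (hx : x ∈ Φ L) : orthonormalTransfer hf hg x ∈ Ψ L :=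
  _root_.orthonormalTransfer_mem hf hg (hΨ.closed L hL) fun i ↦ ((ha i).le_or_le h𝒩 hL).imp
    (fun h ↦ inner_left_of_mem_orthogonal (hΦ.mono h hx) (hfm i).2)
    (fun h ↦ hΨ.mono h (hgm i).1)

theorem IsNestMap.orthonormalTransfer_self (h𝒩 : IsNest 𝒩) (hΦ : IsNestMap 𝒩 Φ)
    (ha : ∀ i, IsNestAtom 𝒩 (a i).1 (a i).2) (hf : Orthonormal ℂ f)
    (hfm : ∀ i, f i ∈ Φ (a i).2 ⊓ (Φ (a i).1)ᗮ) (hf0 : ∀ x ∈ Φ ⊤, (∀ i, ⟪f i, x⟫ = 0) → x = 0)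
    {x : G} (hx : x ∈ Φ ⊤) : orthonormalTransfer hf hf x = x := by
  have hmem := hΦ.orthonormalTransfer_mem h𝒩 hΦ ha hf hf hfm hfm h𝒩.top_mem hx
  refine (sub_eq_zero.1 (hf0 _ (sub_mem hx hmem) fun i ↦ ?_)).symm
  rw [inner_sub_right, inner_orthonormalTransfer_self, sub_self]

end

theorem IsNestMap.exists_intertwiner (h𝒩 : IsNest 𝒩) (hc : 𝒩.Countable)
    (hΦ : IsNestMap 𝒩 Φ) (hΨ : IsNestMap 𝒩 Ψ)
    (hΦd : ∀ M N, IsNestAtom 𝒩 M N → FiniteDimensional ℂ ↥(Φ N ⊓ (Φ M)ᗮ))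
    (hΨd : ∀ M N, IsNestAtom 𝒩 M N → FiniteDimensional ℂ ↥(Ψ N ⊓ (Ψ M)ᗮ))
    (hd : ∀ M N, IsNestAtom 𝒩 M N →
      Module.finrank ℂ ↥(Φ N ⊓ (Φ M)ᗮ) = Module.finrank ℂ ↥(Ψ N ⊓ (Ψ M)ᗮ)) :
    ∃ X Y : G →L[ℂ] G, (∀ L ∈ 𝒩, ∀ x ∈ Φ L, X x ∈ Ψ L) ∧ (∀ L ∈ 𝒩, ∀ x ∈ Ψ L, Y x ∈ Φ L) ∧
      (∀ x ∈ Φ ⊤, Y (X x) = x) ∧ ∀ x ∈ Ψ ⊤, X (Y x) = x := by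
  obtain ⟨f, hf, hfm, hf0⟩ := hΦ.exists_orthonormal h𝒩 hc
    (fun a ↦ Module.finrank ℂ ↥(Ψ a.1.2 ⊓ (Ψ a.1.1)ᗮ)) (fun a ↦ hΦd _ _ a.2) (fun a ↦ hd _ _ a.2)
  obtain ⟨g, hg, hgm, hg0⟩ := hΨ.exists_orthonormal h𝒩 hc
    (fun a ↦ Module.finrank ℂ ↥(Ψ a.1.2 ⊓ (Ψ a.1.1)ᗮ)) (fun a ↦ hΨd _ _ a.2) (fun a ↦ rfl)
  refine ⟨orthonormalTransfer hf hg, orthonormalTransfer hg hf,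
    fun L hL x ↦ hΦ.orthonormalTransfer_mem h𝒩 hΨ (fun i ↦ i.1.2) hf hg hfm hgm hL,
    fun L hL x ↦ hΨ.orthonormalTransfer_mem h𝒩 hΦ (fun i ↦ i.1.2) hg hf hgm hfm hL,
    fun x hx ↦ ?_, fun x hx ↦ ?_⟩
  · rw [orthonormalTransfer_transfer]
    exact hΦ.orthonormalTransfer_self h𝒩 (fun i ↦ i.1.2) hf hfm hf0 hx
  · rw [orthonormalTransfer_transfer]
    exact hΨ.orthonormalTransfer_self h𝒩 (fun i ↦ i.1.2) hg hgm hg0 hx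

end Atomic

section Power

variable {H : Type*} [NormedAddCommGroup H] [InnerProductSpace ℂ H] {n : ℕ}

/-- The `j`-th coordinate inclusion of `H` in the direct sum of `n` copies of `H`. -/
noncomputable def coordIncl (j : Fin n) : H →L[ℂ] PiLp 2 (fun _ : Fin n ↦ H) :=
  (PiLp.continuousLinearEquiv 2 ℂ (fun _ : Fin n ↦ H)).symm.toContinuousLinearMap ∘L
    ContinuousLinearMap.single ℂ (fun _ : Fin n ↦ H) j

theorem coordIncl_apply (j i : Fin n) (x : H) : coordIncl j x i = if i = j then x else 0 := by
  change (Pi.single j x : Fin n → H) i = _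
  rw [Pi.single_apply]

theorem sum_coordIncl (x : PiLp 2 (fun _ : Fin n ↦ H)) : ∑ j, coordIncl j (x j) = x := by
  ext i
  rw [WithLp.ofLp_sum, Finset.sum_apply]
  simp [coordIncl_apply]

/-- The direct sum of `n` copies of a subspace. -/
def powSubmodule (n : ℕ) (N : Submodule ℂ H) : Submodule ℂ (PiLp 2 (fun _ : Fin n ↦ H)) :=
  ⨅ i, N.comap (PiLp.proj 2 (𝕜 := ℂ) (fun _ : Fin n ↦ H) i : _ →ₗ[ℂ] H)

theorem mem_powSubmodule {N : Submodule ℂ H} {x : PiLp 2 (fun _ : Fin n ↦ H)} :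
    x ∈ powSubmodule n N ↔ ∀ i, x i ∈ N := by
  simp [powSubmodule, mem_iInf]

theorem coordIncl_mem_powSubmodule {N : Submodule ℂ H} {x : H} (hx : x ∈ N) (j : Fin n) :
    coordIncl j x ∈ powSubmodule n N := mem_powSubmodule.2 fun i ↦ by
  rw [coordIncl_apply]
  split_ifs
  exacts [hx, N.zero_mem]

theorem powSubmodule_mono : Monotone (powSubmodule (H := H) n) := fun _ _ h _ hx ↦
  mem_powSubmodule.2 fun i ↦ h (mem_powSubmodule.1 hx i)

theorem isClosed_powSubmodule {N : Submodule ℂ H} (hN : IsClosed (N : Set H)) :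
    IsClosed (powSubmodule n N : Set (PiLp 2 (fun _ : Fin n ↦ H))) := by
  have : (powSubmodule n N : Set (PiLp 2 (fun _ : Fin n ↦ H))) =
      ⋂ i, (fun x : PiLp 2 (fun _ : Fin n ↦ H) ↦ x i) ⁻¹' N := by
    ext x
    simp [mem_powSubmodule]
  rw [this]
  exact isClosed_iInter fun i ↦ hN.preimage (by fun_prop)

theorem powSubmodule_closure_sSup_le (S : Set (Submodule ℂ H)) :
    powSubmodule n (sSup S).topologicalClosure ≤
      (⨆ L : S, powSubmodule n (L : Submodule ℂ H)).topologicalClosure := by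
  intro x hx
  rw [← sum_coordIncl x]
  refine sum_mem fun j _ ↦ ?_
  have hle : (sSup S).topologicalClosure ≤
      (⨆ L : S, powSubmodule n (L : Submodule ℂ H)).topologicalClosure.comap
        ((coordIncl j : H →L[ℂ] PiLp 2 (fun _ : Fin n ↦ H)) : H →ₗ[ℂ] _) := by
    refine topologicalClosure_minimal _ (sSup_le fun L hL y hy ↦ ?_)
      ((isClosed_topologicalClosure _).preimage (coordIncl j).continuous)
    exact le_topologicalClosure _ (mem_iSup_of_mem ⟨L, hL⟩ (coordIncl_mem_powSubmodule hy j))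
  exact hle (mem_powSubmodule.1 hx j)

/-- A row and a column over the nest algebra with product `1`. -/
structure IsUnimodularPair (𝒩 : Set (Submodule ℂ H)) (A : PiLp 2 (fun _ : Fin n ↦ H) →L[ℂ] H)
    (C : H →L[ℂ] PiLp 2 (fun _ : Fin n ↦ H)) : Prop where
  row_mem : ∀ L ∈ 𝒩, ∀ x ∈ powSubmodule n L, A x ∈ L
  col_mem : ∀ L ∈ 𝒩, ∀ x ∈ L, C x ∈ powSubmodule n L
  row_col : ∀ x, A (C x) = x

variable {𝒩 : Set (Submodule ℂ H)} {A A' : PiLp 2 (fun _ : Fin n ↦ H) →L[ℂ] H}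
  {C C' : H →L[ℂ] PiLp 2 (fun _ : Fin n ↦ H)}

/-- The part of the kernel of a row lying over an element of the nest. -/
noncomputable def rowKer (A : PiLp 2 (fun _ : Fin n ↦ H) →L[ℂ] H) (N : Submodule ℂ H) :
    Submodule ℂ (PiLp 2 (fun _ : Fin n ↦ H)) :=
  powSubmodule n N ⊓ LinearMap.ker (A : PiLp 2 (fun _ : Fin n ↦ H) →ₗ[ℂ] H)

theorem mem_rowKer {N : Submodule ℂ H} {x : PiLp 2 (fun _ : Fin n ↦ H)} :
    x ∈ rowKer A N ↔ x ∈ powSubmodule n N ∧ A x = 0 := Iff.rfl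

theorem IsUnimodularPair.sub_mem_rowKer (hAC : IsUnimodularPair 𝒩 A C) {L : Submodule ℂ H}
    (hL : L ∈ 𝒩) {x : PiLp 2 (fun _ : Fin n ↦ H)} (hx : x ∈ powSubmodule n L) :
    x - C (A x) ∈ rowKer A L :=
  ⟨sub_mem hx (hAC.col_mem L hL _ (hAC.row_mem L hL x hx)), by
    change A (x - C (A x)) = 0
    rw [map_sub, hAC.row_col, sub_self]⟩

theorem IsUnimodularPair.isNestMap (h𝒩 : IsNest 𝒩) (hAC : IsUnimodularPair 𝒩 A C) :
    IsNestMap 𝒩 (rowKer A) where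
  mono _ _ h := inf_le_inf_right _ (powSubmodule_mono h)
  closed N hN := (isClosed_powSubmodule (h𝒩.closed N hN)).inter A.isClosed_ker
  map_bot := by
    refine (Submodule.eq_bot_iff _).2 fun x hx ↦ ?_
    ext i
    exact (mem_bot ℂ).1 (mem_powSubmodule.1 hx.1 i)
  map_sSup S hS x hx := by
    let D : PiLp 2 (fun _ : Fin n ↦ H) →L[ℂ] PiLp 2 (fun _ : Fin n ↦ H) :=
      ContinuousLinearMap.id ℂ _ - C ∘L A
    have hx' : D x = x := by
      change x - C (A x) = x
      rw [(mem_rowKer.1 hx).2, map_zero, sub_zero]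
    rw [← hx']
    have hle : (⨆ L : S, powSubmodule n (L : Submodule ℂ H)).topologicalClosure ≤
        (⨆ L : S, rowKer A (L : Submodule ℂ H)).topologicalClosure.comap
          (D : _ →ₗ[ℂ] PiLp 2 (fun _ : Fin n ↦ H)) := by
      refine topologicalClosure_minimal _ (iSup_le fun L y hy ↦ ?_)
        ((isClosed_topologicalClosure _).preimage D.continuous)
      exact le_topologicalClosure _ (mem_iSup_of_mem L (hAC.sub_mem_rowKer (hS L.2) hy))
    exact hle (powSubmodule_closure_sSup_le S hx.1)
  map_sInf S hS hne x hx := by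
    rw [mem_iInf] at hx
    obtain ⟨L, hL⟩ := hne
    refine mem_rowKer.2 ⟨mem_powSubmodule.2 fun i ↦ (mem_sInf).2 fun K hK ↦ ?_, (hx ⟨L, hL⟩).2⟩
    exact mem_powSubmodule.1 (hx ⟨K, hK⟩).1 i

variable [CompleteSpace H]

theorem IsUnimodularPair.finrank_add (h𝒩 : IsNest 𝒩) (hAC : IsUnimodularPair 𝒩 A C)
    {M N : Submodule ℂ H} (hat : IsNestAtom 𝒩 M N) [FiniteDimensional ℂ ↥(N ⊓ Mᗮ)] :
    FiniteDimensional ℂ ↥(rowKer A N ⊓ (rowKer A M)ᗮ) ∧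
      Module.finrank ℂ ↥(rowKer A N ⊓ (rowKer A M)ᗮ) + Module.finrank ℂ ↥(N ⊓ Mᗮ) =
        n * Module.finrank ℂ ↥(N ⊓ Mᗮ) := by
  obtain ⟨hM, hN, hMN, -⟩ := hat
  have : CompleteSpace M := (h𝒩.closed M hM).completeSpace_coe
  have : CompleteSpace ↥(rowKer A M) :=
    ((hAC.isNestMap h𝒩).closed M hM).completeSpace_coe
  let E := N ⊓ Mᗮ
  let q : H →ₗ[ℂ] E := (E.orthogonalProjectionOnto : H →ₗ[ℂ] E)
  have hqM : ∀ y ∈ M, q y = 0 := fun y hy ↦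
    orthogonalProjectionOnto_apply_of_mem_orthogonal
      (orthogonal_le inf_le_right (le_orthogonal_orthogonal M hy))
  have hqE : ∀ y : E, q y = y := fun y ↦ orthogonalProjectionOnto_mem_subspace_eq_self y
  have hqN : ∀ y ∈ N, y - q y ∈ M := by
    intro y hy
    have h1 : y - M.starProjection y ∈ E :=
      ⟨sub_mem hy (hMN.le (starProjection_apply_mem _ y)), sub_starProjection_mem_orthogonal y⟩
    have h2 : q y = ⟨_, h1⟩ := by
      rw [← hqE ⟨_, h1⟩, map_sub, hqM _ (starProjection_apply_mem _ y), sub_zero]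
    rw [h2]
    simp
  let T : PiLp 2 (fun _ : Fin n ↦ H) →ₗ[ℂ] Fin n → E :=
    LinearMap.pi fun i ↦ q ∘ₗ (PiLp.proj 2 (𝕜 := ℂ) (fun _ : Fin n ↦ H) i : _ →ₗ[ℂ] H)
  let J : (Fin n → E) →ₗ[ℂ] PiLp 2 (fun _ : Fin n ↦ H) :=
    ∑ i, ((coordIncl i : H →L[ℂ] PiLp 2 (fun _ : Fin n ↦ H)) : H →ₗ[ℂ] _) ∘ₗ
      E.subtype ∘ₗ LinearMap.proj i
  have hT : ∀ x i, T x i = q (x i) := fun x i ↦ rfl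
  have hJ : ∀ v i, J v i = v i := fun v i ↦ by
    simp only [J, LinearMap.sum_apply, WithLp.ofLp_sum, Finset.sum_apply]
    simp [coordIncl_apply]
  have hTM : ∀ x ∈ powSubmodule n M, T x = 0 := fun x hx ↦
    funext fun i ↦ hqM _ (mem_powSubmodule.1 hx i)
  have hTN : ∀ x ∈ powSubmodule n N, x - J (T x) ∈ powSubmodule n M := fun x hx ↦
    mem_powSubmodule.2 fun i ↦ by
      rw [PiLp.sub_apply, hJ, hT]
      exact hqN _ (mem_powSubmodule.1 hx i)
  have hTJ : ∀ v, T (J v) = v := fun v ↦ funext fun i ↦ by rw [hT, hJ, hqE]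
  have hJN : ∀ v, J v ∈ powSubmodule n N := fun v ↦ mem_powSubmodule.2 fun i ↦ by
    rw [hJ]; exact (v i).2.1
  let R : (Fin n → E) →ₗ[ℂ] E := q ∘ₗ (A : _ →ₗ[ℂ] H) ∘ₗ J
  have hR : ∀ x ∈ powSubmodule n N, R (T x) = q (A x) := fun x hx ↦ by
    have h1 := hqM _ (hAC.row_mem M hM _ (hTN x hx))
    rw [map_sub, map_sub, sub_eq_zero] at h1
    exact h1.symm
  have hRsurj : LinearMap.range R = ⊤ := LinearMap.range_eq_top.2 fun y ↦
    ⟨T (C y), by rw [hR _ (hAC.col_mem N hN _ y.2.1), hAC.row_col, hqE]⟩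
  let W := rowKer A N ⊓ (rowKer A M)ᗮ
  have hinj : Function.Injective (T ∘ₗ W.subtype) := by
    rw [injective_iff_map_eq_zero]
    rintro ⟨x, ⟨hxN, hxA⟩, hxM⟩ hx
    have h1 := hTN x hxN
    rw [show T x = 0 from hx, map_zero, sub_zero] at h1
    exact Subtype.ext (inner_self_eq_zero.1 (inner_right_of_mem_orthogonal
      (mem_rowKer.2 ⟨h1, hxA⟩) hxM))
  have hrange : LinearMap.range (T ∘ₗ W.subtype) = LinearMap.ker R := by
    ext v
    constructor
    · rintro ⟨⟨x, ⟨hxN, hxA⟩, hxM⟩, rfl⟩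
      change R (T x) = 0
      rw [hR x hxN, show A x = 0 from hxA, map_zero]
    · intro hv
      have hAv : A (J v) ∈ M := by
        have h1 := hqN _ (hAC.row_mem N hN _ (hJN v))
        rwa [show q (A (J v)) = 0 from hv, ZeroMemClass.coe_zero, sub_zero] at h1
      set x := J v - C (A (J v)) with hx
      have hxN : x ∈ rowKer A N := hAC.sub_mem_rowKer hN (hJN v)
      have hp := starProjection_apply_mem (rowKer A M) x
      refine ⟨⟨x - (rowKer A M).starProjection x,
        sub_mem hxN ((hAC.isNestMap h𝒩).mono hMN.le hp), sub_starProjection_mem_orthogonal x⟩, ?_⟩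
      change T (x - _) = v
      rw [map_sub, hTM _ hp.1, sub_zero, hx, map_sub, hTJ, hTM _ (hAC.col_mem M hM _ hAv), sub_zero]
  refine ⟨FiniteDimensional.of_injective _ hinj, ?_⟩
  have h1 := R.finrank_range_add_finrank_ker
  rw [hRsurj, finrank_top, ← hrange, LinearMap.finrank_range_of_inj hinj, add_comm,
    Module.finrank_pi_fintype] at h1
  simpa using h1

end Power

section Completion

variable {H : Type*} [NormedAddCommGroup H] [InnerProductSpace ℂ H] {n : ℕ}
  {𝒩 : Set (Submodule ℂ H)} {A A' : PiLp 2 (fun _ : Fin n ↦ H) →L[ℂ] H}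
  {C C' : H →L[ℂ] PiLp 2 (fun _ : Fin n ↦ H)}

/-- If `X` carries the kernel of the row `A` to that of `A'`, with inverse `Y`, then the operators
`C' A + X (1 - C A)` and `C A' + Y (1 - C' A')` are inverse to each other. -/
theorem IsUnimodularPair.transfer_comp (h𝒩 : IsNest 𝒩) (hAC : IsUnimodularPair 𝒩 A C)
    (hAC' : IsUnimodularPair 𝒩 A' C')
    {X Y : PiLp 2 (fun _ : Fin n ↦ H) →L[ℂ] PiLp 2 (fun _ : Fin n ↦ H)}
    (hX : ∀ x ∈ rowKer A ⊤, X x ∈ rowKer A' ⊤) (hYX : ∀ x ∈ rowKer A ⊤, Y (X x) = x)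
    (x : PiLp 2 (fun _ : Fin n ↦ H)) :
    A' (C' (A x) + X (x - C (A x))) = A x ∧
      C (A' (C' (A x) + X (x - C (A x)))) +
        Y (C' (A x) + X (x - C (A x)) - C' (A' (C' (A x) + X (x - C (A x))))) = x := by
  have hk : x - C (A x) ∈ rowKer A ⊤ :=
    hAC.sub_mem_rowKer h𝒩.top_mem (mem_powSubmodule.2 fun _ ↦ mem_top)
  have h1 : A' (C' (A x) + X (x - C (A x))) = A x := by
    rw [map_add, hAC'.row_col, (mem_rowKer.1 (hX _ hk)).2, add_zero]
  refine ⟨h1, ?_⟩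
  rw [h1, add_sub_cancel_left, hYX _ hk, add_sub_cancel]

theorem IsUnimodularPair.exists_equiv [CompleteSpace H] (h𝒩 : IsNest 𝒩) (hc : 𝒩.Countable)
    (hfd : ∀ M N, IsNestAtom 𝒩 M N → FiniteDimensional ℂ ↥(N ⊓ Mᗮ))
    (hAC : IsUnimodularPair 𝒩 A C) (hAC' : IsUnimodularPair 𝒩 A' C') :
    ∃ W W' : PiLp 2 (fun _ : Fin n ↦ H) →L[ℂ] PiLp 2 (fun _ : Fin n ↦ H),
      (∀ L ∈ 𝒩, ∀ x ∈ powSubmodule n L, W x ∈ powSubmodule n L) ∧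
      (∀ L ∈ 𝒩, ∀ x ∈ powSubmodule n L, W' x ∈ powSubmodule n L) ∧
      (∀ x, W (W' x) = x) ∧ (∀ x, W' (W x) = x) ∧ ∀ x, A' (W x) = A x := by
  obtain ⟨X, Y, hX, hY, hYX, hXY⟩ := (hAC.isNestMap h𝒩).exists_intertwiner h𝒩 hc
    (hAC'.isNestMap h𝒩)
    (fun M N hat ↦ have := hfd M N hat; (hAC.finrank_add h𝒩 hat).1)
    (fun M N hat ↦ have := hfd M N hat; (hAC'.finrank_add h𝒩 hat).1)
    (fun M N hat ↦ have := hfd M N hat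
      Nat.add_right_cancel ((hAC.finrank_add h𝒩 hat).2.trans (hAC'.finrank_add h𝒩 hat).2.symm))
  have hW := hAC.transfer_comp h𝒩 hAC' (hX ⊤ h𝒩.top_mem) hYX
  have hW' := hAC'.transfer_comp h𝒩 hAC (hY ⊤ h𝒩.top_mem) hXY
  refine ⟨C' ∘L A + X ∘L (.id ℂ _ - C ∘L A), C ∘L A' + Y ∘L (.id ℂ _ - C' ∘L A'),
    fun L hL x hx ↦ ?_, fun L hL x hx ↦ ?_, fun x ↦ (hW' x).2, fun x ↦ (hW x).2,
    fun x ↦ (hW x).1⟩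
  · exact add_mem (hAC'.col_mem L hL _ (hAC.row_mem L hL x hx))
      (hX L hL _ (hAC.sub_mem_rowKer hL hx)).1
  · exact add_mem (hAC.col_mem L hL _ (hAC'.row_mem L hL x hx))
      (hY L hL _ (hAC'.sub_mem_rowKer hL hx)).1

theorem isUnimodularPair_of_sum_eq_one {a c : Fin n → H →L[ℂ] H} (ha : ∀ i, a i ∈ nestAlg 𝒩)
    (hc : ∀ i, c i ∈ nestAlg 𝒩) (h : ∑ i, a i * c i = 1) :
    IsUnimodularPair 𝒩 (∑ i, a i ∘L PiLp.proj 2 (𝕜 := ℂ) (fun _ : Fin n ↦ H) i)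
      (∑ i, coordIncl i ∘L c i) where
  row_mem L hL x hx := by
    rw [sum_apply]
    exact sum_mem fun i _ ↦ ha i L hL _ (mem_powSubmodule.1 hx i)
  col_mem L hL x hx := by
    rw [sum_apply]
    exact sum_mem fun i _ ↦ coordIncl_mem_powSubmodule (hc i L hL x hx) i
  row_col x := by
    have hx : (∑ i, a i * c i) x = x := by rw [h]; rfl
    conv_rhs => rw [← hx]
    rw [sum_apply, sum_apply, sum_apply]
    refine Finset.sum_congr rfl fun i _ ↦ ?_
    change a i ((∑ j, coordIncl j (c j x) : PiLp 2 (fun _ : Fin n ↦ H)) i) = a i (c i x)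
    rw [WithLp.ofLp_sum, Finset.sum_apply]
    simp [coordIncl_apply]

theorem isUnimodularPair_proj (j : Fin n) :
    IsUnimodularPair 𝒩 (PiLp.proj 2 (𝕜 := ℂ) (fun _ : Fin n ↦ H) j) (coordIncl j) where
  row_mem _ _ _ hx := mem_powSubmodule.1 hx j
  col_mem _ _ _ hx := coordIncl_mem_powSubmodule hx j
  row_col x := by
    change coordIncl j x j = x
    rw [coordIncl_apply, if_pos rfl]

/-- The matrix of an operator on the direct sum of `n` copies of `H`. -/
noncomputable def opMatrix (W : PiLp 2 (fun _ : Fin n ↦ H) →L[ℂ] PiLp 2 (fun _ : Fin n ↦ H)) :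
    Matrix (Fin n) (Fin n) (H →L[ℂ] H) :=
  .of fun i j ↦ PiLp.proj 2 (𝕜 := ℂ) (fun _ : Fin n ↦ H) i ∘L W ∘L coordIncl j

theorem opMatrix_mul_eq_one
    {W W' : PiLp 2 (fun _ : Fin n ↦ H) →L[ℂ] PiLp 2 (fun _ : Fin n ↦ H)}
    (h : ∀ x, W (W' x) = x) : opMatrix W * opMatrix W' = 1 := by
  ext i k x
  rw [Matrix.mul_apply, sum_apply]
  have h1 : ∑ j, (opMatrix W i j * opMatrix W' j k) x =
      (∑ j, W (coordIncl j (W' (coordIncl k x) j)) : PiLp 2 (fun _ : Fin n ↦ H)) i := by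
    rw [WithLp.ofLp_sum, Finset.sum_apply]
    rfl
  rw [h1, ← map_sum, sum_coordIncl, h, coordIncl_apply, Matrix.one_apply]
  split_ifs <;> rfl

theorem opMatrix_mem_nestAlg
    {W : PiLp 2 (fun _ : Fin n ↦ H) →L[ℂ] PiLp 2 (fun _ : Fin n ↦ H)}
    (h : ∀ L ∈ 𝒩, ∀ x ∈ powSubmodule n L, W x ∈ powSubmodule n L) (i j : Fin n) :
    opMatrix W i j ∈ nestAlg 𝒩 := fun L hL _ hx ↦
  mem_powSubmodule.1 (h L hL _ (coordIncl_mem_powSubmodule hx j)) i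

theorem IsNest.completelyFiniteIn [CompleteSpace H] (h𝒩 : IsNest 𝒩) (hc : 𝒩.Countable)
    (hfd : ∀ M N, IsNestAtom 𝒩 M N → FiniteDimensional ℂ ↥(N ⊓ Mᗮ)) :
    CompletelyFiniteIn (nestAlg 𝒩) := by
  intro n hn a c ha hc' h
  obtain ⟨W, W', hW, hW', hWW', hW'W, hrow⟩ :=
    (isUnimodularPair_of_sum_eq_one ha hc' h).exists_equiv h𝒩 hc hfd
      (isUnimodularPair_proj ⟨0, Nat.lt_of_lt_of_le Nat.zero_lt_one hn⟩)
  refine ⟨opMatrix W, opMatrix W', opMatrix_mem_nestAlg hW, opMatrix_mem_nestAlg hW',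
    opMatrix_mul_eq_one hWW', opMatrix_mul_eq_one hW'W, fun j ↦ ?_⟩
  ext x
  refine (hrow (coordIncl j x)).trans ?_
  rw [sum_apply]
  change ∑ i, a i (coordIncl j x i) = a j x
  rw [Finset.sum_eq_single j (fun i _ hij ↦ ?_) (by simp), coordIncl_apply, if_pos rfl]
  rw [coordIncl_apply, if_neg hij, map_zero]

end Completion

/-- **Theorem.**  For a nest `𝒩` on a separable complex Hilbert space, the nest
algebra `T(𝒩)` is completely finite if and only if `𝒩` is countable and every
atom of `𝒩` (an interval `N ⊖ M` with no element of `𝒩` strictly between `M`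
and `N`) is finite dimensional. -/
theorem nestAlgebra_completelyFinite_iff
    {H : Type*} [NormedAddCommGroup H] [InnerProductSpace ℂ H]
    [CompleteSpace H] [TopologicalSpace.SeparableSpace H]
    {𝒩 : Set (Submodule ℂ H)} (h𝒩 : IsNest 𝒩) :
    CompletelyFiniteIn (nestAlg 𝒩) ↔
      (𝒩.Countable ∧
        ∀ M ∈ 𝒩, ∀ N ∈ 𝒩, M < N → (∀ L ∈ 𝒩, ¬(M < L ∧ L < N)) →
          FiniteDimensional ℂ ↥(N ⊓ Mᗮ)) := by
  refine ⟨fun h ↦ ⟨h𝒩.countable_of_completelyFiniteIn h, fun M hM N hN _ hat ↦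
    h𝒩.finiteDimensional_atom h hM hN hat⟩, fun h ↦ h𝒩.completelyFiniteIn h.1
    fun M N hat ↦ h.2 M hat.1 N hat.2.1 hat.2.2.1 hat.2.2.2⟩
end
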